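/- Well-posedness for the additive kernel: Let ν₀ be a positive Radon measure on (0,∞) with m₁ = ∫ x ν₀(dx) < ∞. Then Smoluchowski's coagulation equation with kernel K=x+y has exactly one measure-valued solution on [0,∞) (in the weak sense below) with initial data ν₀, and this solution conserves mass: ∫ x ν_t(dx) = m₁ for all t ∈ [0,∞). -/

import Mathlib

/-!
Well-posedness of Smoluchowski's coagulation equation with additive kernel
K = x + y for measure-valued initial data of finite mass (Menon–Pego, Theorem 2.8).
-/

open MeasureTheory Filter Topology Set Real

noncomputable section

/-- Membership in E₁ ⊂ C¹(Ē): continuously differentiable on (0,∞), f and f′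
have finite limits at 0 and ∞, f(0⁺) = 0, and f′ decays exponentially. -/
def MemE1 (f : ℝ → ℝ) : Prop :=
  (∀ x : ℝ, 0 < x → HasDerivAt f (deriv f x) x) ∧
  ContinuousOn f (Set.Ioi 0) ∧
  ContinuousOn (deriv f) (Set.Ioi 0) ∧
  Tendsto f (𝓝[>] (0:ℝ)) (𝓝 0) ∧
  (∃ a : ℝ, Tendsto (deriv f) (𝓝[>] (0:ℝ)) (𝓝 a)) ∧
  (∃ b : ℝ, Tendsto f atTop (𝓝 b)) ∧
  (∃ b' : ℝ, Tendsto (deriv f) atTop (𝓝 b')) ∧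
  (∃ C α : ℝ, 0 < α ∧ ∀ x : ℝ, 0 < x → |deriv f x| ≤ C * Real.exp (-α * x))

/-- The coagulation pairing
`⟨f, L(ν)⟩ = ½ ∫∫ [f(x+y) − f(x) − f(y)] K(x,y) ν(dx) ν(dy)`. -/
def coagPairing (K : ℝ → ℝ → ℝ) (ν : Measure ℝ) (f : ℝ → ℝ) : ℝ :=
  (1/2) * ∫ p in (Set.Ioi (0:ℝ)) ×ˢ (Set.Ioi (0:ℝ)),
    (f (p.1 + p.2) - f p.1 - f p.2) * K p.1 p.2 ∂(ν.prod ν)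

/-- The first moment m₁(ν) = ∫ x ν(dx) ∈ [0,∞]. -/
def massMoment (ν : Measure ℝ) : ENNReal :=
  ∫⁻ x in Set.Ioi (0:ℝ), ENNReal.ofReal x ∂ν

/-- Measure-valued weak solution of Smoluchowski's coagulation equation with
additive kernel K = x + y (homogeneity degree γ = 1) and initial data ν₀. -/
def IsCoagSolutionAdd (ν₀ : Measure ℝ) (ν : ℝ → Measure ℝ) : Prop :=
  -- measures concentrated on (0,∞)
  (∀ t : ℝ, 0 ≤ t → (ν t) (Set.Iic 0) = 0) ∧
  -- (2) measurability of t ↦ ν_t(B) for compact B ⊂ (0,∞)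
  (∀ B : Set ℝ, IsCompact B → B ⊆ Set.Ioi 0 →
    Measurable fun t => ((ν t) B).toReal) ∧
  -- (3) local square-integrability of the first moment m₁(τ)
  (∀ t : ℝ, 0 < t →
    IntegrableOn (fun τ => ((massMoment (ν τ)).toReal) ^ 2) (Set.Ioc 0 t) volume) ∧
  -- (4) weak form of the equation for all test functions f ∈ E₁
  (∀ f : ℝ → ℝ, MemE1 f → ∀ t : ℝ, 0 ≤ t →
    (∀ τ ∈ Set.Icc (0:ℝ) t,
      IntegrableOn (fun p : ℝ × ℝ => (f (p.1 + p.2) - f p.1 - f p.2) * (p.1 + p.2))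
        ((Set.Ioi (0:ℝ)) ×ˢ (Set.Ioi (0:ℝ))) ((ν τ).prod (ν τ))) ∧
    IntegrableOn f (Set.Ioi 0) (ν t) ∧ IntegrableOn f (Set.Ioi 0) ν₀ ∧
    ∫ x in Set.Ioi (0:ℝ), f x ∂(ν t) =
      (∫ x in Set.Ioi (0:ℝ), f x ∂ν₀) +
        ∫ τ in (0:ℝ)..t, coagPairing (fun x y => x + y) (ν τ) f)

open scoped NNReal ENNReal

/-! ### Completely monotone functions, through positivity of functionals -/

/-- `g` is nonnegative against every nonnegative exponential sum. -/
def CMon (g : ℝ≥0 → ℝ) : Prop :=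
  ∀ c : ℝ≥0 →₀ ℝ, (∀ u ∈ Icc (0:ℝ) 1, 0 ≤ c.sum fun s a => a * u ^ (s:ℝ)) →
    0 ≤ c.sum fun s a => a * g s

def powMap (s : ℝ≥0) : C(unitInterval, ℝ) :=
  ⟨fun u => (u:ℝ) ^ (s:ℝ), by
    exact (Real.continuous_rpow_const s.2).comp continuous_subtype_val⟩

lemma CMon.rep {g : ℝ≥0 → ℝ} (hg : CMon g) :
    ∃ μ : Measure unitInterval, IsFiniteMeasure μ ∧ ∀ s : ℝ≥0, g s = ∫ u, (u:ℝ) ^ (s:ℝ) ∂μ := by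
  set T : (ℝ≥0 →₀ ℝ) →ₗ[ℝ] C(unitInterval, ℝ) := Finsupp.linearCombination ℝ powMap with hT
  set L : (ℝ≥0 →₀ ℝ) →ₗ[ℝ] ℝ := Finsupp.linearCombination ℝ g with hL
  have hTe : ∀ c u, T c u = c.sum fun s a => a * (u:ℝ) ^ (s:ℝ) := by
    intro c u
    simp only [hT, Finsupp.linearCombination_apply, Finsupp.sum]
    rw [ContinuousMap.coe_sum, Finset.sum_apply]
    rfl
  have hLe : ∀ c, L c = c.sum fun s a => a * g s := by
    intro c
    simp [hL, Finsupp.linearCombination_apply]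
  have hpos : ∀ c, 0 ≤ T c → 0 ≤ L c := by
    intro c hc
    rw [hLe]
    apply hg c
    intro u hu
    have h1 : 0 ≤ T c ⟨u, hu⟩ := hc ⟨u, hu⟩
    rw [hTe] at h1
    exact h1
  have hker : L ∈ (LinearMap.ker T).dualAnnihilator := by
    rw [Submodule.mem_dualAnnihilator]
    intro c hc
    rw [LinearMap.mem_ker] at hc
    apply le_antisymm
    · have := hpos (-c) (by rw [map_neg, hc]; simp)
      rw [map_neg] at this
      linarith
    · exact hpos c (by rw [hc])
  rw [← LinearMap.range_dualMap_eq_dualAnnihilator_ker] at hker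
  obtain ⟨φ, hφ⟩ := hker
  have hφ' : ∀ c, φ (T c) = L c := fun c => by rw [← hφ]; rfl
  obtain ⟨Λ, hΛ1, hΛ2⟩ := riesz_extension (PointedCone.positive ℝ C(unitInterval, ℝ))
    ⟨LinearMap.range T, φ.domRestrict (LinearMap.range T)⟩ (by
      rintro ⟨x, c, rfl⟩ hx
      have : 0 ≤ T c := by simpa using hx
      change 0 ≤ φ (T c)
      rw [hφ']
      exact hpos c this) (by
      intro y
      refine ⟨⟨T (Finsupp.single 0 ‖y‖), LinearMap.mem_range_self _ _⟩, ?_⟩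
      rw [PointedCone.mem_positive]
      intro u
      have h1 := (abs_le.1 (y.norm_coe_le_norm u)).1
      change 0 ≤ T (Finsupp.single 0 ‖y‖) u + y u
      rw [hTe]
      simp
      linarith)
  have hΛT : ∀ c, Λ (T c) = L c := by
    intro c
    have := hΛ1 ⟨T c, LinearMap.mem_range_self _ _⟩
    rw [← hφ']
    exact this
  let Λ' : CompactlySupportedContinuousMap unitInterval ℝ →ₚ[ℝ] ℝ :=
  { toFun := fun f => Λ f.toContinuousMap
    map_add' := fun f h => by
      rw [← map_add]; rfl
    map_smul' := fun c f => by
      rw [RingHom.id_apply, ← map_smul]; rfl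
    monotone' := fun f h hfh => by
      have h1 : 0 ≤ Λ (h.toContinuousMap - f.toContinuousMap) := by
        apply hΛ2
        rw [PointedCone.mem_positive]
        intro u
        have := hfh u
        simpa using this
      rw [map_sub] at h1
      linarith }
  refine ⟨RealRMK.rieszMeasure Λ', ?_, ?_⟩
  · constructor
    let o : CompactlySupportedContinuousMap unitInterval ℝ :=
    { toFun := 1
      hasCompactSupport' := HasCompactSupport.of_compactSpace 1 }
    have : RealRMK.rieszMeasure Λ' univ ≤ ENNReal.ofReal (Λ' o) :=
      RealRMK.rieszMeasure_le_of_eq_one Λ'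
        (fun x ↦ by simp [o]) isCompact_univ (fun x ↦ by simp [o])
    exact this.trans_lt ENNReal.ofReal_lt_top
  · intro s
    let p : CompactlySupportedContinuousMap unitInterval ℝ :=
    { toContinuousMap := powMap s
      hasCompactSupport' := HasCompactSupport.of_compactSpace _ }
    have h1 := RealRMK.integral_rieszMeasure Λ' p
    have h2 : Λ' p = g s := by
      have : Λ (T (Finsupp.single s 1)) = g s := by
        rw [hΛT, hLe]; simp
      rw [← this]
      change Λ (powMap s) = _
      congr 1
      simp [hT]
    rw [← h2, ← h1]
    rfl

lemma CMon.of_rep (μ : Measure unitInterval) [IsFiniteMeasure μ] (c : ℝ≥0 →₀ ℝ)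
    (hc : ∀ u ∈ Icc (0:ℝ) 1, 0 ≤ c.sum fun s a => a * u ^ (s:ℝ)) :
    0 ≤ c.sum fun s a => a * ∫ u, (u:ℝ) ^ (s:ℝ) ∂μ := by
  have : (c.sum fun s a => a * ∫ u, (u:ℝ) ^ (s:ℝ) ∂μ)
      = ∫ u : unitInterval, (c.sum fun s a => a * (u:ℝ) ^ (s:ℝ)) ∂μ := by
    simp only [Finsupp.sum]
    rw [integral_finsetSum]
    · simp only [integral_const_mul]
    · intro s _
      apply Integrable.const_mul
      exact (powMap s).continuous.integrable_of_hasCompactSupport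
        (HasCompactSupport.of_compactSpace _)
  rw [this]
  exact integral_nonneg fun u => hc u u.2

lemma CMon.mul {g h : ℝ≥0 → ℝ} (hg : CMon g) (hh : CMon h) : CMon (fun s => g s * h s) := by
  intro c hc
  obtain ⟨μ, hμ, hμg⟩ := hg.rep
  obtain ⟨ν, hν, hνh⟩ := hh.rep
  -- step 1 : twisted coefficients
  have key : ∀ u ∈ Icc (0:ℝ) 1, 0 ≤ c.sum fun s a => (a * h s) * u ^ (s:ℝ) := by
    intro u hu
    let d : ℝ≥0 →₀ ℝ := Finsupp.onFinset c.support (fun s => c s * u ^ (s:ℝ)) (by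
      intro s hs
      rw [Finsupp.mem_support_iff]
      intro h0
      simp [h0] at hs)
    have hd : ∀ F : ℝ≥0 → ℝ, (d.sum fun s a => a * F s) = c.sum fun s a => a * u ^ (s:ℝ) * F s := by
      intro F
      rw [Finsupp.onFinset_sum _ (by simp)]
      rfl
    have h1 := CMon.of_rep ν d (by
      intro v hv
      rw [hd (fun s => v ^ (s:ℝ))]
      have := hc (u * v) ⟨mul_nonneg hu.1 hv.1, mul_le_one₀ hu.2 hv.1 hv.2⟩
      simpa only [Real.mul_rpow hu.1 hv.1, mul_assoc] using this)
    rw [hd] at h1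
    simp only [hνh]
    convert h1 using 4
    ring
  let d : ℝ≥0 →₀ ℝ := Finsupp.onFinset c.support (fun s => c s * h s) (by
      intro s hs
      rw [Finsupp.mem_support_iff]
      intro h0
      simp [h0] at hs)
  have hd : ∀ F : ℝ≥0 → ℝ, (d.sum fun s a => a * F s) = c.sum fun s a => a * h s * F s := by
    intro F
    rw [Finsupp.onFinset_sum _ (by simp)]
    rfl
  have h1 := CMon.of_rep μ d (by
      intro v hv
      rw [hd (fun s => v ^ (s:ℝ))]
      exact key v hv)
  rw [hd] at h1
  convert h1 using 4
  rw [← hμg]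
  ring

lemma CMon.add {g h : ℝ≥0 → ℝ} (hg : CMon g) (hh : CMon h) : CMon (fun s => g s + h s) := by
  intro c hc
  have := add_nonneg (hg c hc) (hh c hc)
  rw [← Finsupp.sum_add] at this
  simpa only [mul_add] using this

lemma CMon.const_mul {g : ℝ≥0 → ℝ} (hg : CMon g) {r : ℝ} (hr : 0 ≤ r) :
    CMon (fun s => r * g s) := by
  intro c hc
  have := mul_nonneg hr (hg c hc)
  simp only [Finsupp.sum, Finset.mul_sum] at this ⊢
  refine this.trans_eq (Finset.sum_congr rfl fun s _ => by ring)

lemma CMon.exp_neg {x : ℝ} (hx : 0 ≤ x) : CMon (fun s => Real.exp (-x * s)) := by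
  intro c hc
  have := hc (Real.exp (-x)) ⟨(Real.exp_pos _).le, by simpa using hx⟩
  simpa only [← Real.exp_mul] using this

lemma CMon.one : CMon (fun _ => 1) := by
  simpa using CMon.exp_neg (x := 0) le_rfl

lemma CMon.pow {g : ℝ≥0 → ℝ} (hg : CMon g) (n : ℕ) : CMon (fun s => g s ^ n) := by
  induction n with
  | zero => simpa using CMon.one
  | succ n ih =>
    simp only [pow_succ]
    exact ih.mul hg

lemma CMon.lim {ι : Type*} {l : Filter ι} [l.NeBot] {G : ι → ℝ≥0 → ℝ} {g : ℝ≥0 → ℝ}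
    (hG : ∀ i, CMon (G i)) (hlim : ∀ s, Tendsto (fun i => G i s) l (𝓝 (g s))) : CMon g := by
  intro c hc
  have : Tendsto (fun i => c.sum fun s a => a * G i s) l (𝓝 (c.sum fun s a => a * g s)) := by
    simp only [Finsupp.sum]
    exact tendsto_finsetSum _ fun s _ => (hlim s).const_mul _
  exact ge_of_tendsto' this fun i => hG i c hc

lemma CMon.mix {α : Type*} [MeasurableSpace α] {μ : Measure α} {G : α → ℝ≥0 → ℝ}
    (hG : ∀ᵐ x ∂μ, CMon (G x)) (hintg : ∀ s, Integrable (fun x => G x s) μ) :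
    CMon (fun s => ∫ x, G x s ∂μ) := by
  intro c hc
  have : (c.sum fun s a => a * ∫ x, G x s ∂μ) = ∫ x, (c.sum fun s a => a * G x s) ∂μ := by
    simp only [Finsupp.sum]
    rw [integral_finsetSum]
    · simp only [integral_const_mul]
    · intro s _
      exact (hintg s).const_mul _
  rw [this]
  exact integral_nonneg_of_ae (hG.mono fun x hx => hx c hc)

lemma CMon.finsum {g : ℕ → ℝ≥0 → ℝ} (hg : ∀ n, CMon (g n)) (n : ℕ) :
    CMon (fun s => ∑ i ∈ Finset.range n, g i s) := by
  induction n with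
  | zero => 
    intro c hc
    simp
  | succ n ih =>
    simp only [Finset.sum_range_succ]
    exact ih.add (hg n)

lemma CMon.hasSum {g : ℕ → ℝ≥0 → ℝ} {G : ℝ≥0 → ℝ} (hg : ∀ n, CMon (g n))
    (hs : ∀ s, HasSum (fun n => g n s) (G s)) : CMon G :=
  CMon.lim (fun n => CMon.finsum hg n) fun s => (hs s).tendsto_sum_nat

lemma CMon.exp {g : ℝ≥0 → ℝ} (hg : CMon g) : CMon (fun s => Real.exp (g s)) := by
  refine CMon.hasSum (g := fun n s => (n.factorial : ℝ)⁻¹ * g s ^ n)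
    (fun n => (hg.pow n).const_mul (by positivity)) fun s => ?_
  have := NormedSpace.expSeries_div_hasSum_exp (𝔸 := ℝ) (g s)
  rw [Real.exp_eq_exp_ℝ]
  simp only [div_eq_inv_mul] at this
  exact this

lemma CMon.geom {g : ℝ≥0 → ℝ} (hg : CMon g) (h0 : ∀ s, 0 ≤ g s) (h1 : ∀ s, g s < 1) :
    CMon (fun s => (1 - g s)⁻¹) :=
  CMon.hasSum (fun n => hg.pow n) fun s => hasSum_geometric_of_lt_one (h0 s) (h1 s)

/-! ### Measures on the half line with finite mass -/

structure Good (ν : Measure ℝ) : Prop where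
  supp : ν (Iic 0) = 0
  int : Integrable (fun x : ℝ => x) ν

def mass (ν : Measure ℝ) : ℝ := ∫ x, x ∂ν
def Phi (ν : Measure ℝ) (s : ℝ) : ℝ := ∫ x, (1 - Real.exp (-s * x)) ∂ν
def Dphi (ν : Measure ℝ) (s : ℝ) : ℝ := ∫ x, x * Real.exp (-s * x) ∂ν

lemma ae_pos_of_supp {ν : Measure ℝ} (h : ν (Iic 0) = 0) : ∀ᵐ x ∂ν, 0 < x := by
  rw [ae_iff]
  convert h using 2
  ext x
  simp

lemma restrict_of_supp {ν : Measure ℝ} (h : ν (Iic 0) = 0) : ν.restrict (Ioi 0) = ν :=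
  Measure.restrict_eq_self_of_ae_mem (ae_pos_of_supp h)

lemma sigmaFinite_of_int {ν : Measure ℝ} {f : ℝ → ℝ} (hf : Integrable f ν)
    (hpos : ∀ᵐ x ∂ν, 0 < f x) : SigmaFinite ν := by
  refine Measure.sigmaFinite_of_countable
    (S := insert {x | ¬ 0 < f x} (range fun n : ℕ => {x | (1 / ((n:ℝ) + 1)) ≤ f x}))
    ((countable_range _).insert _) ?_ ?_
  · rintro s (rfl | ⟨n, rfl⟩)
    · rw [ae_iff] at hpos
      rw [hpos]; simp
    · exact hf.measure_ge_lt_top (by positivity)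
  · rw [eq_univ_iff_forall]
    intro x
    by_cases hx : 0 < f x
    · obtain ⟨n, hn⟩ := exists_nat_one_div_lt hx
      exact ⟨_, Or.inr ⟨n, rfl⟩, hn.le⟩
    · exact ⟨_, Or.inl rfl, hx⟩

/-! Elementary exponential bounds -/

lemma one_sub_exp_nonneg {s x : ℝ} (hs : 0 ≤ s) (hx : 0 ≤ x) : 0 ≤ 1 - Real.exp (-s * x) := by
  have : Real.exp (-s * x) ≤ 1 := Real.exp_le_one_iff.2 (by nlinarith [mul_nonneg hs hx])
  linarith

lemma one_sub_exp_le (s x : ℝ) : 1 - Real.exp (-s * x) ≤ s * x := by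
  have := Real.add_one_le_exp (-s * x)
  linarith

lemma exp_diff_nonneg {s s' x : ℝ} (h : s ≤ s') (hx : 0 ≤ x) :
    0 ≤ Real.exp (-s * x) - Real.exp (-s' * x) := by
  have : Real.exp (-s' * x) ≤ Real.exp (-s * x) := Real.exp_le_exp.2 (by nlinarith)
  linarith

lemma exp_diff_eq (s s' x : ℝ) : Real.exp (-s * x) - Real.exp (-s' * x)
    = Real.exp (-s * x) * (1 - Real.exp (-(s' - s) * x)) := by
  rw [mul_sub, ← Real.exp_add]; ring_nf

lemma exp_neg_mul_le_one {s x : ℝ} (hs : 0 ≤ s) (hx : 0 ≤ x) : Real.exp (-s * x) ≤ 1 := by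
  have := one_sub_exp_nonneg hs hx
  linarith

lemma exp_diff_le {s s' x : ℝ} (hs : 0 ≤ s) (h : s ≤ s') (hx : 0 ≤ x) :
    Real.exp (-s * x) - Real.exp (-s' * x) ≤ (s' - s) * x := by
  rw [exp_diff_eq]
  calc _ ≤ 1 * (1 - Real.exp (-(s' - s) * x)) := by
        gcongr
        · exact one_sub_exp_nonneg (by linarith) hx
        · exact exp_neg_mul_le_one hs hx
    _ ≤ _ := by rw [one_mul]; exact one_sub_exp_le _ _

lemma mul_exp_le_one (y : ℝ) : y * Real.exp (-y) ≤ 1 := by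
  have h1 := Real.add_one_le_exp y
  have h2 := Real.exp_pos (-y)
  have h3 : Real.exp y * Real.exp (-y) = 1 := by rw [← Real.exp_add]; simp
  nlinarith

lemma exp_diff_le' {d s s' x : ℝ} (hd : 0 < d) (hs : d ≤ s) (h : s ≤ s') (hx : 0 ≤ x) :
    Real.exp (-s * x) - Real.exp (-s' * x) ≤ (s' - s) / d := by
  rw [exp_diff_eq]
  have h1 : Real.exp (-s * x) ≤ Real.exp (-d * x) := by
    have := exp_diff_nonneg hs hx
    linarith
  have h2 := mul_exp_le_one (d * x)
  rw [← neg_mul] at h2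
  calc _ ≤ Real.exp (-d * x) * ((s' - s) * x) := by
        gcongr
        · exact one_sub_exp_nonneg (by linarith) hx
        · exact one_sub_exp_le _ _
    _ = (s' - s) / d * (d * x * Real.exp (-d * x)) := by field_simp
    _ ≤ (s' - s) / d * 1 := by
        gcongr
    _ = _ := mul_one _

namespace Good

lemma ae_pos {ν : Measure ℝ} (h : Good ν) : ∀ᵐ x ∂ν, 0 < x := ae_pos_of_supp h.supp

lemma restr {ν : Measure ℝ} (h : Good ν) : ν.restrict (Ioi 0) = ν := restrict_of_supp h.supp

lemma sigmaFinite {ν : Measure ℝ} (h : Good ν) : SigmaFinite ν := sigmaFinite_of_int h.int h.ae_pos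

lemma mass_nonneg {ν : Measure ℝ} (h : Good ν) : 0 ≤ mass ν := integral_nonneg_of_ae (h.ae_pos.mono fun _ hx => le_of_lt hx)

lemma massMoment_eq {ν : Measure ℝ} (h : Good ν) : massMoment ν = ENNReal.ofReal (mass ν) := by
  rw [massMoment, h.restr, mass,
    ofReal_integral_eq_lintegral_ofReal h.int (h.ae_pos.mono fun _ hx => le_of_lt hx)]

lemma integrable_of {ν : Measure ℝ} (h : Good ν) {g : ℝ → ℝ} (hg : AEStronglyMeasurable g ν) {C : ℝ}
    (hb : ∀ x, 0 < x → |g x| ≤ C * x) : Integrable g ν :=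
  (h.int.const_mul C).mono' hg (h.ae_pos.mono fun x hx => hb x hx)

lemma abs_integral_le {ν : Measure ℝ} (h : Good ν) {g : ℝ → ℝ} {C : ℝ}
    (hb : ∀ x, 0 < x → |g x| ≤ C * x) : |∫ x, g x ∂ν| ≤ C * mass ν := by
  rw [mass, ← integral_const_mul]
  exact norm_integral_le_of_norm_le (f := g) (h.int.const_mul C) (h.ae_pos.mono fun x hx => hb x hx)

lemma int_phi {ν : Measure ℝ} (h : Good ν) {s : ℝ} (hs : 0 ≤ s) : Integrable (fun x => 1 - Real.exp (-s * x)) ν := by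
  refine h.integrable_of (by fun_prop) (C := s) fun x hx => ?_
  rw [abs_of_nonneg (one_sub_exp_nonneg hs hx.le)]
  exact one_sub_exp_le _ _

lemma int_dphi {ν : Measure ℝ} (h : Good ν) {s : ℝ} (hs : 0 ≤ s) : Integrable (fun x => x * Real.exp (-s * x)) ν := by
  refine h.integrable_of (by fun_prop) (C := 1) fun x hx => ?_
  rw [abs_of_nonneg (by positivity), mul_comm]
  gcongr
  exact exp_neg_mul_le_one hs hx.le

lemma int_aux {ν : Measure ℝ} (h : Good ν) {s : ℝ} (hs : 0 ≤ s) : Integrable (fun x => x * (1 - Real.exp (-s * x))) ν := by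
  have := h.int.sub (h.int_dphi hs)
  refine this.congr (ae_of_all _ fun x => ?_)
  simp only [Pi.sub_apply]
  ring

lemma integral_aux {ν : Measure ℝ} (h : Good ν) {s : ℝ} (hs : 0 ≤ s) :
    ∫ x, x * (1 - Real.exp (-s * x)) ∂ν = mass ν - Dphi ν s := by
  rw [mass, Dphi, ← integral_sub h.int (h.int_dphi hs)]
  congr 1
  ext x
  ring

lemma phi_nonneg {ν : Measure ℝ} (h : Good ν) {s : ℝ} (hs : 0 ≤ s) : 0 ≤ Phi ν s :=
  integral_nonneg_of_ae (h.ae_pos.mono fun _ hx => one_sub_exp_nonneg hs (le_of_lt hx))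

lemma phi_sub {ν : Measure ℝ} (h : Good ν) {s s' : ℝ} (hs : 0 ≤ s) (hs' : 0 ≤ s') :
    Phi ν s' - Phi ν s = ∫ x, (Real.exp (-s * x) - Real.exp (-s' * x)) ∂ν := by
  rw [Phi, Phi, ← integral_sub (h.int_phi hs') (h.int_phi hs)]
  congr 1
  ext x
  ring

lemma phi_mono {ν : Measure ℝ} (h : Good ν) {s s' : ℝ} (hs : 0 ≤ s) (hss : s ≤ s') : Phi ν s ≤ Phi ν s' := by
  have h1 := h.phi_sub hs (hs.trans hss)
  have : 0 ≤ ∫ x, (Real.exp (-s * x) - Real.exp (-s' * x)) ∂ν :=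
    integral_nonneg_of_ae (h.ae_pos.mono fun _ hx => exp_diff_nonneg hss (le_of_lt hx))
  linarith

lemma phi_lip' {ν : Measure ℝ} (h : Good ν) {s s' : ℝ} (hs : 0 ≤ s) (hss : s ≤ s') : Phi ν s' - Phi ν s ≤ mass ν * (s' - s) := by
  rw [h.phi_sub hs (hs.trans hss)]
  have := h.abs_integral_le (g := fun x => Real.exp (-s * x) - Real.exp (-s' * x)) (C := s' - s) (by
    intro x hx
    rw [abs_of_nonneg (exp_diff_nonneg hss hx.le)]
    exact exp_diff_le hs hss hx.le)
  rw [mul_comm]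
  exact (le_abs_self _).trans this

lemma phi_lip {ν : Measure ℝ} (h : Good ν) {s s' : ℝ} (hs : 0 ≤ s) (hs' : 0 ≤ s') :
    |Phi ν s' - Phi ν s| ≤ mass ν * |s' - s| := by
  rcases le_total s s' with hss | hss
  · rw [abs_of_nonneg (by linarith [h.phi_mono hs hss]), abs_of_nonneg (by linarith)]
    exact h.phi_lip' hs hss
  · rw [abs_sub_comm, abs_sub_comm s', abs_of_nonneg (by linarith [h.phi_mono hs' hss]),
      abs_of_nonneg (by linarith)]
    exact h.phi_lip' hs' hss

lemma _root_.phi_zero {ν : Measure ℝ} : Phi ν 0 = 0 := by simp [Phi]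

lemma phi_le {ν : Measure ℝ} (h : Good ν) {s : ℝ} (hs : 0 ≤ s) : Phi ν s ≤ mass ν * s := by
  have := h.phi_lip' le_rfl hs
  rw [phi_zero] at this
  simpa using this

lemma phi_cont {ν : Measure ℝ} (h : Good ν) : ContinuousOn (Phi ν) (Ici 0) := by
  have : LipschitzOnWith (mass ν).toNNReal (Phi ν) (Ici 0) := by
    refine LipschitzOnWith.of_dist_le_mul fun x hx y hy => ?_
    rw [Real.coe_toNNReal _ h.mass_nonneg, Real.dist_eq, Real.dist_eq]
    exact h.phi_lip hy hx
  exact this.continuousOn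

lemma _root_.dphi_zero {ν : Measure ℝ} : Dphi ν 0 = mass ν := by simp [Dphi, mass]

lemma dphi_nonneg {ν : Measure ℝ} (h : Good ν) (s : ℝ) : 0 ≤ Dphi ν s :=
  integral_nonneg_of_ae (h.ae_pos.mono fun x hx => by
    have : 0 < x := hx
    positivity)

lemma dphi_le {ν : Measure ℝ} (h : Good ν) {s : ℝ} (hs : 0 ≤ s) : Dphi ν s ≤ mass ν := by
  have h1 := h.integral_aux hs
  have : 0 ≤ ∫ x, x * (1 - Real.exp (-s * x)) ∂ν :=
    integral_nonneg_of_ae (h.ae_pos.mono fun x hx =>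
      mul_nonneg (le_of_lt hx) (one_sub_exp_nonneg hs (le_of_lt hx)))
  linarith

lemma dphi_lip' {ν : Measure ℝ} (h : Good ν) {d s s' : ℝ} (hd : 0 < d) (hs : d ≤ s) (hss : s ≤ s') :
    |Dphi ν s' - Dphi ν s| ≤ mass ν / d * (s' - s) := by
  have h0 : 0 ≤ s := hd.le.trans hs
  rw [abs_sub_comm, Dphi, Dphi, ← integral_sub (h.int_dphi h0) (h.int_dphi (h0.trans hss))]
  have := h.abs_integral_le (g := fun x => x * Real.exp (-s * x) - x * Real.exp (-s' * x))
    (C := (s' - s) / d) (by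
    intro x hx
    rw [← mul_sub, abs_of_nonneg (mul_nonneg hx.le (exp_diff_nonneg hss hx.le)), mul_comm]
    gcongr
    exact exp_diff_le' hd hs hss hx.le)
  refine this.trans_eq ?_
  ring

lemma dphi_lip {ν : Measure ℝ} (h : Good ν) {d s s' : ℝ} (hd : 0 < d) (hs : d ≤ s) (hs' : d ≤ s') :
    |Dphi ν s' - Dphi ν s| ≤ mass ν / d * |s' - s| := by
  rcases le_total s s' with hss | hss
  · rw [abs_of_nonneg (sub_nonneg.2 hss)]
    exact h.dphi_lip' hd hs hss
  · rw [abs_sub_comm, abs_sub_comm s', abs_of_nonneg (sub_nonneg.2 hss)]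
    exact h.dphi_lip' hd hs' hss

lemma hasDerivAt_phi {ν : Measure ℝ} (h : Good ν) {s : ℝ} (hs : 0 < s) : HasDerivAt (Phi ν) (Dphi ν s) s := by
  refine (hasDerivAt_integral_of_dominated_loc_of_deriv_le (μ := ν) (s := Ioi 0)
    (F := fun s x => 1 - Real.exp (-s * x)) (F' := fun s x => x * Real.exp (-s * x))
    (bound := fun x => x) (Ioi_mem_nhds hs) ?_ (h.int_phi hs.le) (by fun_prop) ?_ h.int ?_).2
  · exact Eventually.of_forall fun s => by fun_prop
  · filter_upwards [h.ae_pos] with x hx r hr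
    have hr : 0 < r := hr
    rw [Real.norm_of_nonneg (by positivity)]
    exact mul_le_of_le_one_right hx.le (exp_neg_mul_le_one hr.le hx.le)
  · refine ae_of_all _ fun x r _ => ?_
    have h1 : HasDerivAt (fun r : ℝ => -r * x) (-1 * x) r := ((hasDerivAt_id r).neg).mul_const x
    have h2 := (h1.exp).const_sub 1
    convert h2 using 1
    ring

lemma dphi_cont {ν : Measure ℝ} (h : Good ν) : ContinuousOn (Dphi ν) (Ici 0) := by
  refine continuousOn_of_dominated (bound := fun x => x) ?_ ?_ h.int ?_
  · intro s _
    fun_prop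
  · intro r hr
    filter_upwards [h.ae_pos] with x hx
    have hr : 0 ≤ r := hr
    rw [Real.norm_of_nonneg (by positivity)]
    exact mul_le_of_le_one_right hx.le (exp_neg_mul_le_one hr hx.le)
  · exact ae_of_all _ fun x => by fun_prop

lemma dphi_atTop {ν : Measure ℝ} (h : Good ν) : Tendsto (Dphi ν) atTop (𝓝 0) := by
  have : Tendsto (Dphi ν) atTop (𝓝 (∫ _, (0:ℝ) ∂ν)) := by
    refine tendsto_integral_filter_of_dominated_convergence (fun x => x) ?_ ?_ h.int ?_
    · exact Eventually.of_forall fun s => by fun_prop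
    · filter_upwards [eventually_ge_atTop 0] with r hr
      filter_upwards [h.ae_pos] with x hx
      rw [Real.norm_of_nonneg (by positivity)]
      exact mul_le_of_le_one_right hx.le (exp_neg_mul_le_one hr hx.le)
    · filter_upwards [h.ae_pos] with x hx
      have h1 : Tendsto (fun s : ℝ => -s * x) atTop atBot :=
        (tendsto_neg_atTop_atBot).atBot_mul_const hx
      have := (Real.tendsto_exp_atBot.comp h1).const_mul x
      simpa using this
  simpa using this

/-- `Phi s / s → mass` as `s → 0+`. -/
lemma phi_div_tendsto {ν : Measure ℝ} (h : Good ν) : Tendsto (fun s => Phi ν s / s) (𝓝[>] 0) (𝓝 (mass ν)) := by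
  -- squeeze between Dphi and mass
  have h0 : Tendsto (Dphi ν) (𝓝[>] 0) (𝓝 (mass ν)) := by
    have := (h.dphi_cont 0 self_mem_Ici).mono Ioi_subset_Ici_self
    rw [ContinuousWithinAt, dphi_zero] at this
    exact this
  refine tendsto_of_tendsto_of_tendsto_of_le_of_le' h0 tendsto_const_nhds ?_ ?_
  · filter_upwards [self_mem_nhdsWithin] with s hs
    have hs : 0 < s := hs
    rw [le_div_iff₀ hs, Dphi, Phi, ← integral_mul_const]
    refine integral_mono_ae ((h.int_dphi hs.le).mul_const _) (h.int_phi hs.le) ?_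
    filter_upwards [h.ae_pos] with x hx
    have h1 := Real.add_one_le_exp (s * x)
    have h3 : Real.exp (s * x) * Real.exp (-s * x) = 1 := by rw [← Real.exp_add]; simp
    have h2 := Real.exp_pos (-s * x)
    nlinarith
  · filter_upwards [self_mem_nhdsWithin] with s hs
    have hs : 0 < s := hs
    rw [div_le_iff₀ hs]
    exact h.phi_le hs.le

end Good

lemma good_of_massMoment {ν : Measure ℝ} (hs : ν (Iic 0) = 0) (hm : massMoment ν < ⊤) : Good ν := by
  refine ⟨hs, ?_⟩
  rw [massMoment, restrict_of_supp hs] at hm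
  refine ⟨by fun_prop, ?_⟩
  rw [hasFiniteIntegral_iff_norm]
  refine lt_of_eq_of_lt (lintegral_congr_ae ?_) hm
  filter_upwards [ae_pos_of_supp hs] with x hx
  rw [Real.norm_of_nonneg hx.le]

/-! ### From completely monotone functions to measures -/

lemma CMon.exists_good {G : ℝ≥0 → ℝ} (hG : CMon G)
    (h0 : Tendsto (fun n : ℕ => G (1 / ((n:ℝ≥0) + 1))) atTop (𝓝 (G 0)))
    (h1 : Tendsto (fun n : ℕ => G (n:ℝ≥0)) atTop (𝓝 0)) :
    ∃ ν : Measure ℝ, Good ν ∧ ∀ s : ℝ≥0, Dphi ν s = G s := by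
  obtain ⟨μ, hμ, hrep⟩ := hG.rep
  have hbd : ∀ (s : ℝ≥0) (u : unitInterval), ‖(u:ℝ) ^ (s:ℝ)‖ ≤ 1 := by
    intro s u
    rw [Real.norm_of_nonneg (Real.rpow_nonneg u.2.1 _)]
    exact Real.rpow_le_one u.2.1 u.2.2 s.2
  have hmeas : ∀ s : ℝ≥0, AEStronglyMeasurable (fun u : unitInterval => (u:ℝ) ^ (s:ℝ)) μ :=
    fun s => (powMap s).continuous.aestronglyMeasurable
  -- no atom at 0
  have hz : ∀ᵐ u : unitInterval ∂μ, (u : ℝ) ≠ 0 := by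
    have hlim : Tendsto (fun n : ℕ => G (1 / ((n:ℝ≥0) + 1))) atTop
        (𝓝 (∫ u : unitInterval, (if (u:ℝ) = 0 then 0 else 1 : ℝ) ∂μ)) := by
      simp only [hrep]
      refine tendsto_integral_of_dominated_convergence (fun _ => 1) (fun n => hmeas _)
        (integrable_const _) (fun n => ae_of_all _ (hbd _)) (ae_of_all _ fun u => ?_)
      have hn : Tendsto (fun n : ℕ => (1:ℝ) / ((n:ℝ) + 1)) atTop (𝓝 0) :=
        tendsto_one_div_add_atTop_nhds_zero_nat
      by_cases hu : (u:ℝ) = 0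
      · simp only [hu, if_true]
        refine tendsto_const_nhds.congr fun n => ?_
        rw [Real.zero_rpow]
        positivity
      · simp only [hu, if_false]
        have := (Real.continuousAt_const_rpow (b := 0) hu).tendsto.comp hn
        rw [Real.rpow_zero] at this
        refine this.congr fun n => ?_
        simp
    have heq := tendsto_nhds_unique h0 hlim
    rw [hrep] at heq
    have hmf : Measurable (fun u : unitInterval => (if (u:ℝ) = 0 then 0 else 1 : ℝ)) :=
      Measurable.ite (measurable_subtype_coe (measurableSet_singleton 0)) measurable_const
        measurable_const
    have hintg : Integrable (fun u : unitInterval => (if (u:ℝ) = 0 then 0 else 1 : ℝ)) μ := by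
      refine (integrable_const (1:ℝ)).mono' hmf.aestronglyMeasurable (ae_of_all _ fun u => ?_)
      split_ifs <;> simp
    have h2 : ∫ u : unitInterval, (1 - (if (u:ℝ) = 0 then 0 else 1 : ℝ)) ∂μ = 0 := by
      rw [integral_sub (integrable_const _) hintg, ← heq]
      simp
    have hint2 : Integrable (fun u : unitInterval => (1 - (if (u:ℝ) = 0 then 0 else 1 : ℝ))) μ :=
      (integrable_const (1:ℝ)).sub hintg
    rw [integral_eq_zero_iff_of_nonneg (fun u => by simp only [Pi.zero_apply]; split_ifs <;> simp)
      hint2] at h2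
    filter_upwards [h2] with u hu hu0
    simp [hu0] at hu
  -- no atom at 1
  have ho : ∀ᵐ u : unitInterval ∂μ, (u : ℝ) ≠ 1 := by
    have hlim : Tendsto (fun n : ℕ => G (n:ℝ≥0)) atTop
        (𝓝 (∫ u : unitInterval, (if (u:ℝ) = 1 then 1 else 0 : ℝ) ∂μ)) := by
      simp only [hrep]
      refine tendsto_integral_of_dominated_convergence (fun _ => 1) (fun n => hmeas _)
        (integrable_const _) (fun n => ae_of_all _ (hbd _)) (ae_of_all _ fun u => ?_)
      by_cases hu : (u:ℝ) = 1
      · simp [hu]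
      · simp only [hu, if_false]
        have := tendsto_pow_atTop_nhds_zero_of_lt_one u.2.1 (lt_of_le_of_ne u.2.2 hu)
        refine this.congr fun n => ?_
        simp
    have heq := tendsto_nhds_unique h1 hlim
    have hmf : Measurable (fun u : unitInterval => (if (u:ℝ) = 1 then 1 else 0 : ℝ)) :=
      Measurable.ite (measurable_subtype_coe (measurableSet_singleton 1)) measurable_const
        measurable_const
    have hintg : Integrable (fun u : unitInterval => (if (u:ℝ) = 1 then 1 else 0 : ℝ)) μ := by
      refine (integrable_const (1:ℝ)).mono' hmf.aestronglyMeasurable (ae_of_all _ fun u => ?_)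
      split_ifs <;> simp
    have h2 := heq.symm
    rw [integral_eq_zero_iff_of_nonneg (fun u => by simp only [Pi.zero_apply]; split_ifs <;> simp)
      hintg] at h2
    filter_upwards [h2] with u hu hu0
    simp [hu0] at hu
  have hm : Measurable (fun u : unitInterval => -Real.log (u:ℝ)) := by fun_prop
  set μ' : Measure ℝ := μ.map (fun u : unitInterval => -Real.log (u:ℝ)) with hμ'
  have hfin : IsFiniteMeasure μ' := Measure.isFiniteMeasure_map _ _
  have hpos : ∀ᵐ x ∂μ', 0 < x := by
    rw [hμ', ae_map_iff hm.aemeasurable measurableSet_Ioi]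
    filter_upwards [hz, ho] with u hu0 hu1
    have := Real.log_neg (lt_of_le_of_ne u.2.1 (Ne.symm hu0)) (lt_of_le_of_ne u.2.2 hu1)
    linarith
  have hdm : Measurable (fun x : ℝ => ENNReal.ofReal x⁻¹) := by fun_prop
  set ν : Measure ℝ := μ'.withDensity (fun x => ENNReal.ofReal x⁻¹) with hν
  have hsupp : ν (Iic 0) = 0 := by
    have : μ' (Iic 0) = 0 := by
      rw [ae_iff] at hpos
      convert hpos using 2
      ext x; simp
    exact withDensity_absolutelyContinuous _ _ this
  have hlt : ∀ᵐ x ∂μ', ENNReal.ofReal x⁻¹ < ⊤ := ae_of_all _ fun x => ENNReal.ofReal_lt_top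
  refine ⟨ν, ⟨hsupp, ?_⟩, ?_⟩
  · rw [hν, integrable_withDensity_iff_integrable_smul' hdm hlt]
    refine (integrable_const (1:ℝ)).congr ?_
    filter_upwards [hpos] with x hx
    rw [ENNReal.toReal_ofReal (by positivity), smul_eq_mul, inv_mul_cancel₀ hx.ne']
  · intro s
    rw [Dphi, hν, integral_withDensity_eq_integral_toReal_smul hdm hlt, hrep]
    have : ∫ x, (ENNReal.ofReal x⁻¹).toReal • (x * Real.exp (-(s:ℝ) * x)) ∂μ'
        = ∫ x, Real.exp (-(s:ℝ) * x) ∂μ' := by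
      refine integral_congr_ae ?_
      filter_upwards [hpos] with x hx
      rw [ENNReal.toReal_ofReal (by positivity), smul_eq_mul, ← mul_assoc,
        inv_mul_cancel₀ hx.ne', one_mul]
    rw [this, hμ', integral_map hm.aemeasurable (by fun_prop)]
    refine integral_congr_ae ?_
    filter_upwards [hz] with u hu
    rw [Real.rpow_def_of_pos (lt_of_le_of_ne u.2.1 (Ne.symm hu))]
    ring_nf

/-! ### The inverse characteristic map -/

def psiIter (ν : Measure ℝ) (a s : ℝ) : ℕ → ℝ
  | 0 => s
  | k + 1 => s + a * Phi ν (psiIter ν a s k)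

def psi (ν : Measure ℝ) (a s : ℝ) : ℝ := ⨆ k, psiIter ν a s k

section psi
variable {ν : Measure ℝ} {a s : ℝ}

lemma psiIter_ge (h : Good ν) (ha : 0 ≤ a) (hs : 0 ≤ s) (k : ℕ) : s ≤ psiIter ν a s k := by
  induction k with
  | zero => exact le_rfl
  | succ k ih =>
    have := mul_nonneg ha (h.phi_nonneg (hs.trans ih))
    simp only [psiIter]
    linarith

lemma psiIter_mono (h : Good ν) (ha : 0 ≤ a) (hs : 0 ≤ s) : Monotone (psiIter ν a s) := by
  refine monotone_nat_of_le_succ fun k => ?_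
  induction k with
  | zero => exact psiIter_ge h ha hs 1
  | succ k ih =>
    rw [psiIter, psiIter]
    have := h.phi_mono (hs.trans (psiIter_ge h ha hs k)) ih
    gcongr

lemma psiIter_le (h : Good ν) (ha : 0 ≤ a) (haM : a * mass ν < 1) (hs : 0 ≤ s) (k : ℕ) :
    psiIter ν a s k ≤ s / (1 - a * mass ν) := by
  have hp : 0 < 1 - a * mass ν := by linarith
  have hn := mul_nonneg ha h.mass_nonneg
  induction k with
  | zero =>
    rw [psiIter, le_div_iff₀ hp]
    nlinarith
  | succ k ih =>
    rw [psiIter]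
    have h1 := h.phi_le (hs.trans (psiIter_ge h ha hs k))
    calc s + a * Phi ν (psiIter ν a s k) ≤ s + a * (mass ν * (s / (1 - a * mass ν))) := by
          have := h.mass_nonneg
          gcongr
          exact h1.trans (by gcongr)
      _ = s / (1 - a * mass ν) := by field_simp; ring

lemma psi_tendsto (h : Good ν) (ha : 0 ≤ a) (haM : a * mass ν < 1) (hs : 0 ≤ s) :
    Tendsto (psiIter ν a s) atTop (𝓝 (psi ν a s)) :=
  tendsto_atTop_ciSup (psiIter_mono h ha hs)
    ⟨s / (1 - a * mass ν), by rintro _ ⟨k, rfl⟩; exact psiIter_le h ha haM hs k⟩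

lemma psi_ge (h : Good ν) (ha : 0 ≤ a) (haM : a * mass ν < 1) (hs : 0 ≤ s) : s ≤ psi ν a s :=
  ge_of_tendsto' (psi_tendsto h ha haM hs) (psiIter_ge h ha hs)

lemma psi_le (h : Good ν) (ha : 0 ≤ a) (haM : a * mass ν < 1) (hs : 0 ≤ s) :
    psi ν a s ≤ s / (1 - a * mass ν) :=
  le_of_tendsto' (psi_tendsto h ha haM hs) (psiIter_le h ha haM hs)

lemma psi_fix (h : Good ν) (ha : 0 ≤ a) (haM : a * mass ν < 1) (hs : 0 ≤ s) :
    psi ν a s = s + a * Phi ν (psi ν a s) := by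
  have h1 := psi_tendsto h ha haM hs
  have h2 := h1.comp (tendsto_add_atTop_nat 1)
  refine tendsto_nhds_unique h2 ?_
  have h3 : Tendsto (fun k => Phi ν (psiIter ν a s k)) atTop (𝓝 (Phi ν (psi ν a s))) := by
    have hc := h.phi_cont (psi ν a s) (hs.trans (psi_ge h ha haM hs))
    refine hc.tendsto.comp (tendsto_nhdsWithin_iff.2 ⟨h1, Eventually.of_forall fun k => ?_⟩)
    exact hs.trans (psiIter_ge h ha hs k)
  exact (h3.const_mul a).const_add s

lemma cmon_exp_phi (h : Good ν) {z : ℝ≥0 → ℝ} (hz : ∀ s, 0 ≤ z s)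
    (hc : ∀ y : ℝ, 0 ≤ y → CMon fun s => Real.exp (-y * z s)) {b : ℝ} (hb : 0 ≤ b) :
    CMon fun s => Real.exp (-b * Phi ν (z s)) := by
  set S : ℕ → Set ℝ := fun n => Ici (1 / ((n:ℝ) + 1)) with hS
  have hSmono : Monotone S := by
    intro m n hmn
    apply Ici_subset_Ici.2
    exact one_div_le_one_div_of_le (by positivity) (by gcongr)
  have hSm : ∀ n, MeasurableSet (S n) := fun n => measurableSet_Ici
  have hSU : ⋃ n, S n = Ioi 0 := by
    ext x
    simp only [hS, mem_iUnion, mem_Ici, mem_Ioi]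
    constructor
    · rintro ⟨n, hn⟩
      exact lt_of_lt_of_le (by positivity) hn
    · intro hx
      obtain ⟨n, hn⟩ := exists_nat_one_div_lt hx
      exact ⟨n, hn.le⟩
  have hfin : ∀ n, IsFiniteMeasure (ν.restrict (S n)) := by
    intro n
    refine ⟨?_⟩
    rw [Measure.restrict_apply_univ]
    exact h.int.measure_ge_lt_top (by positivity)
  refine CMon.lim (l := atTop)
    (G := fun (n:ℕ) s => Real.exp (-b * ∫ x in S n, (1 - Real.exp (-(z s) * x)) ∂ν)) ?_ ?_
  · intro n
    have hintg : ∀ s, Integrable (fun x => Real.exp (-x * z s)) (ν.restrict (S n)) := by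
      intro s
      refine (integrable_const (1:ℝ)).mono' (by fun_prop) ?_
      rw [ae_restrict_iff' (hSm n)]
      refine ae_of_all _ fun x hx => ?_
      have hx0 : 0 ≤ x := le_trans (by positivity) hx
      rw [Real.norm_of_nonneg (Real.exp_pos _).le]
      exact exp_neg_mul_le_one hx0 (hz s)
    have hmix : CMon fun s => ∫ x in S n, Real.exp (-x * z s) ∂ν := by
      refine CMon.mix ?_ hintg
      rw [ae_restrict_iff' (hSm n)]
      refine ae_of_all _ fun x hx => hc x (le_trans (by positivity) hx)
    have h1 := (hmix.const_mul hb).exp.const_mul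
      (Real.exp_pos (-b * ∫ x in S n, (1:ℝ) ∂ν)).le
    convert h1 using 2 with s
    rw [← Real.exp_add]
    congr 1
    have : ∫ x in S n, (1 - Real.exp (-(z s) * x)) ∂ν
        = ∫ x in S n, (1:ℝ) ∂ν - ∫ x in S n, Real.exp (-x * z s) ∂ν := by
      rw [← integral_sub (integrable_const _) (hintg s)]
      congr 1
      ext x
      ring_nf
    rw [this]
    ring
  · intro s
    have h1 := tendsto_setIntegral_of_monotone (μ := ν)
      (f := fun x => 1 - Real.exp (-(z s) * x)) hSm hSmono (h.int_phi (hz s)).integrableOn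
    rw [hSU, h.restr] at h1
    exact (Real.continuous_exp.tendsto _).comp (h1.const_mul (-b))

lemma cmon_exp_psi (h : Good ν) (ha : 0 ≤ a) (haM : a * mass ν < 1) {x : ℝ} (hx : 0 ≤ x) :
    CMon fun s => Real.exp (-x * psi ν a s) := by
  have key : ∀ k : ℕ, ∀ x : ℝ, 0 ≤ x → CMon fun s => Real.exp (-x * psiIter ν a s k) := by
    intro k
    induction k with
    | zero => intro x hx; exact CMon.exp_neg hx
    | succ k ih =>
      intro x hx
      have h1 := (CMon.exp_neg hx).mul (cmon_exp_phi h
        (fun s => (NNReal.coe_nonneg s).trans (psiIter_ge h ha (NNReal.coe_nonneg s) k)) ih (mul_nonneg hx ha))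
      convert h1 using 2 with s
      rw [← Real.exp_add, psiIter]
      ring_nf
  refine CMon.lim (l := atTop) (fun k => key k x hx) fun s => ?_
  exact (Real.continuous_exp.tendsto _).comp ((psi_tendsto h ha haM s.2).const_mul (-x))

lemma cmon_dphi_psi (h : Good ν) (ha : 0 ≤ a) (haM : a * mass ν < 1) :
    CMon fun s => Dphi ν (psi ν a s) := by
  have := CMon.mix (μ := ν) (G := fun x (s:ℝ≥0) => x * Real.exp (-x * psi ν a s)) ?_ ?_
  · convert this using 2 with s
    rw [Dphi]
    congr 1
    ext x
    ring_nf
  · filter_upwards [h.ae_pos] with x hx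
    exact (cmon_exp_psi h ha haM hx.le).const_mul hx.le
  · intro s
    refine (h.int_dphi ((NNReal.coe_nonneg s).trans (psi_ge h ha haM (NNReal.coe_nonneg s)))).congr (ae_of_all _ fun x => ?_)
    ring_nf

lemma psi_zero (h : Good ν) (ha : 0 ≤ a) (haM : a * mass ν < 1) : psi ν a 0 = 0 := by
  have h1 := psi_ge h ha haM le_rfl
  have h2 := psi_le h ha haM le_rfl
  rw [zero_div] at h2
  exact le_antisymm h2 h1

theorem exists_coag_measure (h : Good ν) (ha : 0 ≤ a) (haM : a * mass ν < 1) :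
    ∃ ν' : Measure ℝ, Good ν' ∧ ∀ s : ℝ, 0 ≤ s → Dphi ν' s =
      (1 - a * mass ν) * (Dphi ν (psi ν a s) * (1 - a * Dphi ν (psi ν a s))⁻¹) := by
  have hp : 0 < 1 - a * mass ν := by linarith
  have hpsi : ∀ s : ℝ≥0, 0 ≤ psi ν a s := fun s => s.2.trans (psi_ge h ha haM s.2)
  have hlt : ∀ s : ℝ≥0, a * Dphi ν (psi ν a s) < 1 := fun s =>
    lt_of_le_of_lt (mul_le_mul_of_nonneg_left (h.dphi_le (hpsi s)) ha) haM
  have hD := cmon_dphi_psi h ha haM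
  have hG := (hD.mul ((hD.const_mul ha).geom (fun s => mul_nonneg ha (h.dphi_nonneg _))
    hlt)).const_mul hp.le
  -- a general limit principle
  have hlim : ∀ (σ : ℕ → ℝ≥0) (L : ℝ), L ≤ mass ν →
      Tendsto (fun n => Dphi ν (psi ν a (σ n))) atTop (𝓝 L) →
      Tendsto (fun n => (1 - a * mass ν) * (Dphi ν (psi ν a (σ n)) *
        (1 - a * Dphi ν (psi ν a (σ n)))⁻¹)) atTop
        (𝓝 ((1 - a * mass ν) * (L * (1 - a * L)⁻¹))) := by
    intro σ L hL ht
    have : 1 - a * L ≠ 0 := by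
      have := mul_le_mul_of_nonneg_left hL ha
      linarith
    exact (ht.mul (((ht.const_mul a).const_sub 1).inv₀ this)).const_mul _
  obtain ⟨ν', hν', hν''⟩ := hG.exists_good (by
    have := hlim (fun n => 1 / ((n:ℝ≥0) + 1)) (mass ν) le_rfl (by
      have hz : Tendsto (fun n : ℕ => psi ν a ((1 / ((n:ℝ≥0) + 1) : ℝ≥0) : ℝ)) atTop (𝓝[Ici 0] 0) := by
        refine tendsto_nhdsWithin_iff.2 ⟨?_, Eventually.of_forall fun n => hpsi _⟩
        have hn : Tendsto (fun n : ℕ => (1:ℝ) / ((n:ℝ) + 1) / (1 - a * mass ν)) atTop (𝓝 0) := by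
          have := (tendsto_one_div_add_atTop_nhds_zero_nat (𝕜 := ℝ)).div_const (1 - a * mass ν)
          simpa using this
        refine squeeze_zero (fun n => hpsi _) (fun n => ?_) hn
        have := psi_le h ha haM (s := ((1 / ((n:ℝ≥0) + 1) : ℝ≥0) : ℝ)) (NNReal.coe_nonneg _)
        refine this.trans_eq ?_
        simp
      have hc := h.dphi_cont 0 self_mem_Ici
      rw [ContinuousWithinAt, dphi_zero] at hc
      exact hc.comp hz)
    convert this using 3
    rw [NNReal.coe_zero, psi_zero h ha haM, dphi_zero]) (by
    have := hlim (fun n => (n:ℝ≥0)) 0 h.mass_nonneg (by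
      refine h.dphi_atTop.comp ?_
      refine tendsto_atTop_mono (fun n => psi_ge h ha haM (NNReal.coe_nonneg _)) ?_
      simp only [NNReal.coe_natCast]
      exact tendsto_natCast_atTop_atTop)
    simpa using this)
  exact ⟨ν', hν', fun s hs => hν'' ⟨s, hs⟩⟩

end psi

/-! ### Calculus for the characteristic map -/

def aT (M t : ℝ) : ℝ := ∫ r in (0:ℝ)..t, Real.exp (-M * r)

lemma aT_zero (M : ℝ) : aT M 0 = 0 := by simp [aT]

lemma aT_hasDerivAt (M t : ℝ) : HasDerivAt (aT M) (Real.exp (-M * t)) t := by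
  have hc : Continuous fun r : ℝ => Real.exp (-M * r) := by fun_prop
  exact intervalIntegral.integral_hasDerivAt_right (hc.intervalIntegrable _ _)
    hc.aestronglyMeasurable.stronglyMeasurableAtFilter hc.continuousAt

lemma aT_cont (M : ℝ) : Continuous (aT M) :=
  continuous_iff_continuousAt.2 fun t => (aT_hasDerivAt M t).continuousAt

lemma aT_mul (M t : ℝ) : aT M t * M = 1 - Real.exp (-M * t) := by
  have hd : ∀ x, HasDerivAt (fun r : ℝ => -Real.exp (-M * r)) (Real.exp (-M * x) * M) x := by
    intro x
    have := ((hasDerivAt_id x).const_mul (-M)).exp.neg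
    refine this.congr_deriv ?_
    simp only [id, mul_one]
    ring
  have := intervalIntegral.integral_eq_sub_of_hasDerivAt (a := 0) (b := t) (fun x _ => hd x)
    (Continuous.intervalIntegrable (by fun_prop) _ _)
  rw [intervalIntegral.integral_mul_const] at this
  rw [aT, this]
  simp
  ring

lemma aT_nonneg (M : ℝ) {t : ℝ} (ht : 0 ≤ t) : 0 ≤ aT M t :=
  intervalIntegral.integral_nonneg ht fun _ _ => (Real.exp_pos _).le

lemma aT_mul_lt (M t : ℝ) : aT M t * M < 1 := by
  rw [aT_mul]
  have := Real.exp_pos (-M * t)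
  linarith

section psi
variable {ν : Measure ℝ}

lemma psi_lip (h : Good ν) {a a' s s' : ℝ} (ha : 0 ≤ a) (haM : a * mass ν < 1) (ha' : 0 ≤ a')
    (haM' : a' * mass ν < 1) (hs : 0 ≤ s) (hs' : 0 ≤ s') :
    |psi ν a' s' - psi ν a s| * (1 - a * mass ν) ≤ |s' - s| + |a' - a| * Phi ν (psi ν a' s') := by
  have h0 := hs.trans (psi_ge h ha haM hs)
  have h0' := hs'.trans (psi_ge h ha' haM' hs')
  have f := psi_fix h ha haM hs
  have f' := psi_fix h ha' haM' hs'
  have hl := h.phi_lip h0 h0'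
  have hn := h.phi_nonneg h0'
  set z := psi ν a s
  set z' := psi ν a' s'
  have e : z' - z = (s' - s) + (a' - a) * Phi ν z' + a * (Phi ν z' - Phi ν z) := by
    linear_combination f' - f
  have : |z' - z| ≤ |s' - s| + |a' - a| * Phi ν z' + a * (mass ν * |z' - z|) := by
    calc |z' - z| = |(s' - s) + (a' - a) * Phi ν z' + a * (Phi ν z' - Phi ν z)| := by rw [← e]
      _ ≤ |s' - s| + |(a' - a) * Phi ν z'| + |a * (Phi ν z' - Phi ν z)| := abs_add_three _ _ _
      _ ≤ _ := by
        rw [abs_mul, abs_mul, abs_of_nonneg hn, abs_of_nonneg ha]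
        gcongr
  nlinarith

lemma psi_unique (h : Good ν) {a s z : ℝ} (ha : 0 ≤ a) (haM : a * mass ν < 1) (hs : 0 ≤ s)
    (hz : 0 ≤ z) (hf : z = s + a * Phi ν z) : z = psi ν a s := by
  have h0 := hs.trans (psi_ge h ha haM hs)
  have f := psi_fix h ha haM hs
  have hl := h.phi_lip h0 hz
  set w := psi ν a s
  have e : z - w = a * (Phi ν z - Phi ν w) := by linear_combination hf - f
  have : |z - w| ≤ a * (mass ν * |z - w|) := by
    calc |z - w| = |a * (Phi ν z - Phi ν w)| := by rw [← e]
      _ ≤ _ := by rw [abs_mul, abs_of_nonneg ha]; gcongr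
  have h3 : |z - w| = 0 := by
    have := abs_nonneg (z - w)
    nlinarith
  linarith [abs_eq_zero.1 h3]

lemma deriv_aux (h : Good ν) {y B : ℝ → ℝ} {r₀ a : ℝ} (hy : ContinuousAt y r₀) (hy0 : 0 < y r₀)
    (ha : 1 - a * Dphi ν (y r₀) ≠ 0) (hB : ContinuousAt B r₀)
    (heq : ∀ᶠ r in 𝓝 r₀, (y r - y r₀) - a * (Phi ν (y r) - Phi ν (y r₀)) = (r - r₀) * B r) :
    HasDerivAt y (B r₀ / (1 - a * Dphi ν (y r₀))) r₀ := by
  rw [hasDerivAt_iff_tendsto_slope]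
  have hd := h.hasDerivAt_phi hy0
  have hc : Tendsto (fun r => 1 - a * dslope (Phi ν) (y r₀) (y r)) (𝓝 r₀)
      (𝓝 (1 - a * Dphi ν (y r₀))) := by
    have h1 := (continuousAt_dslope_same.2 hd.differentiableAt).tendsto.comp hy.tendsto
    rw [dslope_same, hd.deriv] at h1
    exact (h1.const_mul a).const_sub 1
  have h2 := (hB.tendsto.div hc ha).mono_left (nhdsWithin_le_nhds (s := {r₀}ᶜ))
  refine h2.congr' ?_
  filter_upwards [self_mem_nhdsWithin, heq.filter_mono nhdsWithin_le_nhds,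
    (hc.eventually_ne ha).filter_mono nhdsWithin_le_nhds] with r hr he hne
  have hr' : r - r₀ ≠ 0 := sub_ne_zero.2 hr
  have h3 := sub_smul_dslope (Phi ν) (y r₀) (y r)
  rw [smul_eq_mul] at h3
  simp only [Pi.div_apply]
  rw [slope_def_field, div_eq_div_iff hne hr']
  rw [← h3] at he
  linear_combination -he

def PsiT (ν : Measure ℝ) (t s : ℝ) : ℝ := psi ν (aT (mass ν) t) s

lemma PsiT_ge (h : Good ν) {t s : ℝ} (ht : 0 ≤ t) (hs : 0 ≤ s) : s ≤ PsiT ν t s :=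
  psi_ge h (aT_nonneg _ ht) (aT_mul_lt _ _) hs

lemma PsiT_fix (h : Good ν) {t s : ℝ} (ht : 0 ≤ t) (hs : 0 ≤ s) :
    PsiT ν t s = s + aT (mass ν) t * Phi ν (PsiT ν t s) :=
  psi_fix h (aT_nonneg _ ht) (aT_mul_lt _ _) hs

lemma PsiT_zero (h : Good ν) {s : ℝ} (hs : 0 ≤ s) : PsiT ν 0 s = s := by
  have := PsiT_fix h le_rfl hs
  rwa [aT_zero, zero_mul, add_zero] at this

lemma PsiT_cont_s (h : Good ν) {t : ℝ} (ht : 0 ≤ t) : ContinuousOn (PsiT ν t) (Ici 0) := by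
  have hp : 0 < 1 - aT (mass ν) t * mass ν := by linarith [aT_mul_lt (mass ν) t]
  intro s hs
  refine tendsto_iff_dist_tendsto_zero.2 ?_
  have h1 : Tendsto (fun s' => |s' - s| / (1 - aT (mass ν) t * mass ν)) (𝓝[Ici 0] s) (𝓝 0) := by
    have : Continuous (fun s' => |s' - s| / (1 - aT (mass ν) t * mass ν)) := by fun_prop
    have := this.tendsto s
    simp only [sub_self, abs_zero, zero_div] at this
    exact this.mono_left nhdsWithin_le_nhds
  refine squeeze_zero' (Eventually.of_forall fun _ => dist_nonneg) ?_ h1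
  filter_upwards [self_mem_nhdsWithin] with s' hs'
  rw [le_div_iff₀ hp, Real.dist_eq]
  have := psi_lip h (aT_nonneg _ ht) (aT_mul_lt _ _) (aT_nonneg _ ht) (aT_mul_lt _ _) hs hs'
  simpa [PsiT] using this

lemma PsiT_cont_t (h : Good ν) {s : ℝ} (hs : 0 ≤ s) :
    ContinuousOn (fun t => PsiT ν t s) (Ici 0) := by
  have hp : ∀ t, 0 < 1 - aT (mass ν) t * mass ν := fun t => by linarith [aT_mul_lt (mass ν) t]
  intro t ht
  refine tendsto_iff_dist_tendsto_zero.2 ?_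
  have h1 : Tendsto (fun t' => |aT (mass ν) t - aT (mass ν) t'| * Phi ν (PsiT ν t s) /
      (1 - aT (mass ν) t' * mass ν)) (𝓝[Ici 0] t) (𝓝 0) := by
    have hc := aT_cont (mass ν)
    have : Continuous (fun t' => |aT (mass ν) t - aT (mass ν) t'| * Phi ν (PsiT ν t s) /
      (1 - aT (mass ν) t' * mass ν)) := by
      refine Continuous.div (by fun_prop) (by fun_prop) fun t => (hp t).ne'
    have := this.tendsto t
    simp only [sub_self, abs_zero, zero_mul, zero_div] at this
    exact this.mono_left nhdsWithin_le_nhds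
  refine squeeze_zero' (Eventually.of_forall fun _ => dist_nonneg) ?_ h1
  filter_upwards [self_mem_nhdsWithin] with t' ht'
  rw [le_div_iff₀ (hp _), dist_comm, Real.dist_eq]
  have := psi_lip h (aT_nonneg _ ht') (aT_mul_lt _ _) (aT_nonneg _ ht) (aT_mul_lt _ _) hs hs
  simpa [PsiT] using this

lemma PsiT_den (h : Good ν) {t s : ℝ} (ht : 0 ≤ t) (hs : 0 ≤ s) :
    0 < 1 - aT (mass ν) t * Dphi ν (PsiT ν t s) := by
  have := mul_le_mul_of_nonneg_left (h.dphi_le (hs.trans (PsiT_ge h ht hs)))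
    (aT_nonneg (mass ν) ht)
  linarith [aT_mul_lt (mass ν) t]

lemma PsiT_deriv_s (h : Good ν) {t s : ℝ} (ht : 0 ≤ t) (hs : 0 < s) :
    HasDerivAt (PsiT ν t) (1 / (1 - aT (mass ν) t * Dphi ν (PsiT ν t s))) s := by
  refine deriv_aux h (B := fun _ => 1) ((PsiT_cont_s h ht).continuousAt (Ici_mem_nhds hs))
    (hs.trans_le (PsiT_ge h ht hs.le)) (PsiT_den h ht hs.le).ne' continuousAt_const ?_
  filter_upwards [Ioi_mem_nhds hs] with r hr
  have h1 := PsiT_fix h ht hs.le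
  have h2 := PsiT_fix h ht (le_of_lt hr)
  linear_combination h2 - h1

lemma PsiT_deriv_t (h : Good ν) {t s : ℝ} (ht : 0 < t) (hs : 0 < s) :
    HasDerivAt (fun t => PsiT ν t s) (Real.exp (-mass ν * t) * Phi ν (PsiT ν t s) /
      (1 - aT (mass ν) t * Dphi ν (PsiT ν t s))) t := by
  have hc := (PsiT_cont_t h hs.le).continuousAt (Ici_mem_nhds ht)
  have hpos := (hs.trans_le (PsiT_ge h ht.le hs.le))
  have := deriv_aux h (y := fun t => PsiT ν t s) (r₀ := t)
    (B := fun r => dslope (aT (mass ν)) t r * Phi ν (PsiT ν r s)) hc hpos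
    (PsiT_den h ht.le hs.le).ne' ?_ ?_
  · rwa [dslope_same, (aT_hasDerivAt _ _).deriv] at this
  · refine (continuousAt_dslope_same.2 (aT_hasDerivAt _ _).differentiableAt).mul ?_
    exact (h.hasDerivAt_phi hpos).continuousAt.comp (f := fun t => PsiT ν t s) hc
  · filter_upwards [Ioi_mem_nhds ht] with r hr
    have h1 := PsiT_fix h ht.le hs.le
    have h2 := PsiT_fix h (le_of_lt hr) hs.le
    have h3 := sub_smul_dslope (aT (mass ν)) t r
    rw [smul_eq_mul] at h3
    rw [← mul_assoc, h3]
    linear_combination h2 - h1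

lemma aT_one_sub (M t : ℝ) : 1 - aT M t * M = Real.exp (-M * t) := by rw [aT_mul]; ring

/-- The solution family, at the level of Laplace exponents. -/
theorem exists_sol (h : Good ν) : ∃ N : ℝ → Measure ℝ,
    (∀ t, N t = N (max t 0)) ∧ (∀ t, Good (N t)) ∧ (∀ t, mass (N t) = mass ν) ∧
    (∀ t s, 0 ≤ t → 0 ≤ s → Phi (N t) s = Real.exp (-mass ν * t) * Phi ν (PsiT ν t s)) ∧
    (∀ t s, 0 ≤ t → 0 ≤ s → Dphi (N t) s = Real.exp (-mass ν * t) * (Dphi ν (PsiT ν t s) *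
      (1 - aT (mass ν) t * Dphi ν (PsiT ν t s))⁻¹)) := by
  have hex : ∀ t : ℝ, ∃ ν' : Measure ℝ, Good ν' ∧ ∀ s : ℝ, 0 ≤ s → Dphi ν' s =
      Real.exp (-mass ν * max t 0) * (Dphi ν (PsiT ν (max t 0) s) *
      (1 - aT (mass ν) (max t 0) * Dphi ν (PsiT ν (max t 0) s))⁻¹) := by
    intro t
    rw [← aT_one_sub]
    exact exists_coag_measure h (aT_nonneg _ (le_max_right _ _)) (aT_mul_lt _ _)
  choose N0 hN0 hD0 using hex
  set N : ℝ → Measure ℝ := fun t => N0 (max t 0) with hN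
  have hD : ∀ t s, 0 ≤ t → 0 ≤ s → Dphi (N t) s = Real.exp (-mass ν * t) * (Dphi ν (PsiT ν t s) *
      (1 - aT (mass ν) t * Dphi ν (PsiT ν t s))⁻¹) := by
    intro t s ht hs
    have := hD0 (max t 0) s hs
    have e : N t = N0 t := by simp only [hN, max_eq_left ht]
    rw [max_eq_left (le_max_right t 0), max_eq_left ht, ← e] at this
    exact this
  have hNm : ∀ t, N t = N (max t 0) := by intro t; simp [hN]
  have hG : ∀ t, Good (N t) := fun t => hN0 _
  refine ⟨N, hNm, hG, ?_, ?_, hD⟩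
  · have : ∀ t, 0 ≤ t → mass (N t) = mass ν := by
      intro t ht
      rw [← dphi_zero, hD t 0 ht le_rfl]
      have hz : PsiT ν t 0 = 0 := psi_zero h (aT_nonneg _ ht) (aT_mul_lt _ _)
      rw [hz, dphi_zero, aT_one_sub]
      have := (Real.exp_pos (-mass ν * t)).ne'
      field_simp
    intro t
    rw [hNm]
    exact this _ (le_max_right _ _)
  · intro t s ht hs
    rcases hs.eq_or_lt with rfl | hs'
    · have hz : PsiT ν t 0 = 0 := psi_zero h (aT_nonneg _ ht) (aT_mul_lt _ _)
      rw [hz, phi_zero, phi_zero, mul_zero]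
    have hz : PsiT ν t 0 = 0 := psi_zero h (aT_nonneg _ ht) (aT_mul_lt _ _)
    have hmaps : MapsTo (PsiT ν t) (Ici 0) (Ici 0) := fun r hr =>
      le_trans (mem_Ici.1 hr) (PsiT_ge h ht hr)
    have hcont : ContinuousOn (fun s => Phi (N t) s -
        Real.exp (-mass ν * t) * Phi ν (PsiT ν t s)) (Icc 0 s) := by
      refine ContinuousOn.mono ?_ Icc_subset_Ici_self
      exact (hG t).phi_cont.sub (continuousOn_const.mul (h.phi_cont.comp (PsiT_cont_s h ht) hmaps))
    obtain ⟨c, hc, he⟩ := exists_hasDerivAt_eq_slope _ (fun _ => (0:ℝ)) hs' hcont (by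
      intro x hx
      have hpos := (hx.1.trans_le (PsiT_ge h ht hx.1.le))
      have h1 := (hG t).hasDerivAt_phi hx.1
      have h2 := ((h.hasDerivAt_phi hpos).comp x (PsiT_deriv_s h ht hx.1)).const_mul
        (Real.exp (-mass ν * t))
      have h3 := h1.sub h2
      rw [hD t x ht hx.1.le] at h3
      refine h3.congr_deriv ?_
      rw [one_div, sub_self])
    have hs0 : s - 0 ≠ 0 := by simpa using hs'.ne'
    have := (div_eq_zero_iff.1 he.symm).resolve_right hs0
    rw [hz, phi_zero, phi_zero] at this
    linarith

theorem sol_cont (h : Good ν) {N : ℝ → Measure ℝ} (hNm : ∀ t, N t = N (max t 0))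
    (hP : ∀ t s, 0 ≤ t → 0 ≤ s → Phi (N t) s = Real.exp (-mass ν * t) * Phi ν (PsiT ν t s))
    (hD : ∀ t s, 0 ≤ t → 0 ≤ s → Dphi (N t) s = Real.exp (-mass ν * t) * (Dphi ν (PsiT ν t s) *
      (1 - aT (mass ν) t * Dphi ν (PsiT ν t s))⁻¹)) {s : ℝ} (hs : 0 ≤ s) :
    (Continuous fun t => Phi (N t) s) ∧ Continuous fun t => Dphi (N t) s := by
  have hmaps : MapsTo (fun t => PsiT ν t s) (Ici 0) (Ici 0) := fun r hr =>
      hs.trans (PsiT_ge h hr hs)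
  have hmax : ∀ g : ℝ → ℝ, ContinuousOn g (Ici 0) → Continuous fun t => g (max t 0) :=
    fun g hg => hg.comp_continuous (by fun_prop) fun t => le_max_right t 0
  have hPc := h.phi_cont.comp (PsiT_cont_t h hs) hmaps
  have hDc := h.dphi_cont.comp (PsiT_cont_t h hs) hmaps
  have haT := aT_cont (mass ν)
  constructor
  · have := hmax (fun t => Real.exp (-mass ν * t) * Phi ν (PsiT ν t s))
      (ContinuousOn.mul (by fun_prop) hPc)
    refine this.congr fun t => ?_
    rw [hNm t, hP _ _ (le_max_right _ _) hs]
  · have := hmax (fun t => Real.exp (-mass ν * t) * (Dphi ν (PsiT ν t s) *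
      (1 - aT (mass ν) t * Dphi ν (PsiT ν t s))⁻¹))
      (ContinuousOn.mul (by fun_prop) (hDc.mul (ContinuousOn.inv₀
        (continuousOn_const.sub (haT.continuousOn.mul hDc)) fun t ht => (PsiT_den h ht hs).ne')))
    refine this.congr fun t => ?_
    rw [hNm t, hD _ _ (le_max_right _ _) hs]

theorem sol_evol (h : Good ν) {N : ℝ → Measure ℝ} (hNm : ∀ t, N t = N (max t 0))
    (hP : ∀ t s, 0 ≤ t → 0 ≤ s → Phi (N t) s = Real.exp (-mass ν * t) * Phi ν (PsiT ν t s))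
    (hD : ∀ t s, 0 ≤ t → 0 ≤ s → Dphi (N t) s = Real.exp (-mass ν * t) * (Dphi ν (PsiT ν t s) *
      (1 - aT (mass ν) t * Dphi ν (PsiT ν t s))⁻¹)) {s t : ℝ} (hs : 0 < s) (ht : 0 ≤ t) :
    Phi (N t) s = Phi ν s + ∫ τ in (0:ℝ)..t, -(Phi (N τ) s * (mass ν - Dphi (N τ) s)) := by
  obtain ⟨c1, c2⟩ := sol_cont h hNm hP hD hs.le
  rw [intervalIntegral.integral_eq_sub_of_hasDerivAt_of_le ht (f := fun t => Phi (N t) s)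
    c1.continuousOn]
  · rw [hP 0 s le_rfl hs.le, PsiT_zero h hs.le]
    simp
  · intro x hx
    have hpos := (hs.trans_le (PsiT_ge h hx.1.le hs.le))
    have h1 : HasDerivAt (fun t => Real.exp (-mass ν * t)) (Real.exp (-mass ν * x) * (-mass ν)) x := by
      have := ((hasDerivAt_id x).const_mul (-mass ν)).exp
      refine this.congr_deriv ?_
      simp only [id, mul_one]
    have h2 := h1.mul ((h.hasDerivAt_phi hpos).comp x (PsiT_deriv_t h hx.1 hs))
    refine (h2.congr_of_eventuallyEq ?_).congr_deriv ?_
    · filter_upwards [Ioi_mem_nhds hx.1] with r hr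
      exact hP r s (le_of_lt hr) hs.le
    · rw [hP x s hx.1.le hs.le, hD x s hx.1.le hs.le]
      simp only [Function.comp]
      ring
  · exact Continuous.intervalIntegrable (by fun_prop) _ _

end psi

/-! ### Test functions and the pairing -/

structure TB (ε : ℝ) (f : ℝ → ℝ) : Prop where
  cont : ContinuousOn f (Ioi 0)
  b1 : ∀ x, 0 < x → |f x| ≤ ε * x
  b2 : ∀ x y, 0 < x → 0 < y → |f (x + y) - f x| ≤ ε * y

abbrev pair (ν : Measure ℝ) (f : ℝ → ℝ) : ℝ := coagPairing (fun x y => x + y) ν f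

abbrev integrand (f : ℝ → ℝ) (p : ℝ × ℝ) : ℝ := (f (p.1 + p.2) - f p.1 - f p.2) * (p.1 + p.2)

lemma TB.add {a b : ℝ} {f g : ℝ → ℝ} (hf : TB a f) (hg : TB b g) :
    TB (a + b) (fun x => f x + g x) := by
  refine ⟨hf.cont.add hg.cont, fun x hx => ?_, fun x y hx hy => ?_⟩
  · calc |f x + g x| ≤ |f x| + |g x| := abs_add_le _ _
      _ ≤ a * x + b * x := add_le_add (hf.b1 x hx) (hg.b1 x hx)
      _ = _ := by ring
  · calc |f (x + y) + g (x + y) - (f x + g x)| = |(f (x + y) - f x) + (g (x + y) - g x)| := by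
          ring_nf
      _ ≤ |f (x + y) - f x| + |g (x + y) - g x| := abs_add_le _ _
      _ ≤ a * y + b * y := add_le_add (hf.b2 x y hx hy) (hg.b2 x y hx hy)
      _ = _ := by ring

lemma TB.const_mul {a : ℝ} {f : ℝ → ℝ} (hf : TB a f) (c : ℝ) :
    TB (|c| * a) (fun x => c * f x) := by
  refine ⟨continuousOn_const.mul hf.cont, fun x hx => ?_, fun x y hx hy => ?_⟩
  · rw [abs_mul, mul_assoc]
    have := hf.b1 x hx
    gcongr
  · rw [← mul_sub, abs_mul, mul_assoc]
    have := hf.b2 x y hx hy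
    gcongr

lemma TB.zero : TB 0 (fun _ => 0) := ⟨continuousOn_const, by simp, by simp⟩

lemma TB.sum {n : ℕ} {a : ℕ → ℝ} {g : ℕ → ℝ → ℝ} (hg : ∀ k, TB (a k) (g k)) :
    TB (∑ k ∈ Finset.range n, a k) (fun x => ∑ k ∈ Finset.range n, g k x) := by
  induction n with
  | zero => simpa using TB.zero
  | succ n ih =>
    simp only [Finset.sum_range_succ]
    exact ih.add (hg n)

lemma TB.of_deriv {f f' : ℝ → ℝ} {ε : ℝ} (hd : ∀ x, 0 < x → HasDerivAt f (f' x) x)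
    (hb : ∀ x, 0 < x → |f' x| ≤ ε) (h0 : Tendsto f (𝓝[>] 0) (𝓝 0)) : TB ε f := by
  have key : ∀ x y, 0 < x → 0 < y → |f y - f x| ≤ ε * |y - x| := by
    intro x y hx hy
    exact (convex_Ioi (0:ℝ)).norm_image_sub_le_of_norm_hasDerivWithin_le (f := f) (f' := f')
      (fun z hz => (hd z hz).hasDerivWithinAt) (fun z hz => hb z hz) hx hy
  refine ⟨fun x hx => (hd x hx).continuousAt.continuousWithinAt, fun x hx => ?_,
    fun x y hx hy => ?_⟩
  · have h1 : Tendsto (fun y => |f x - f y|) (𝓝[>] 0) (𝓝 |f x - 0|) := (h0.const_sub _).abs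
    have h2 : Tendsto (fun y => ε * |x - y|) (𝓝[>] 0) (𝓝 (ε * |x - 0|)) := by
      have : Continuous (fun y => ε * |x - y|) := by fun_prop
      exact (this.tendsto 0).mono_left nhdsWithin_le_nhds
    rw [sub_zero] at h1
    rw [sub_zero, abs_of_pos hx] at h2
    refine le_of_tendsto_of_tendsto h1 h2 ?_
    filter_upwards [self_mem_nhdsWithin] with y hy
    exact key y x hy hx
  · have := key x (x + y) hx (by positivity)
    rwa [add_sub_cancel_left, abs_of_pos hy] at this

lemma MemE1.tb {f : ℝ → ℝ} (hf : MemE1 f) : ∃ C, TB C f := by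
  obtain ⟨hd, -, -, h0, -, -, -, C, α, hα, hb⟩ := hf
  refine ⟨C, TB.of_deriv hd (fun x hx => ?_) h0⟩
  have hC : 0 ≤ C := by
    have h1 := (abs_nonneg _).trans (hb x hx)
    exact nonneg_of_mul_nonneg_left h1 (Real.exp_pos _)
  refine (hb x hx).trans ?_
  have : Real.exp (-α * x) ≤ 1 := exp_neg_mul_le_one hα.le hx.le
  nlinarith

lemma expf_deriv (s x : ℝ) : HasDerivAt (fun x => 1 - Real.exp (-s * x)) (s * Real.exp (-s * x)) x := by
  have := ((hasDerivAt_id x).const_mul (-s)).exp.const_sub 1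
  refine this.congr_deriv ?_
  simp only [id, mul_one]
  ring

lemma expf_zero (s : ℝ) : Tendsto (fun x => 1 - Real.exp (-s * x)) (𝓝[>] 0) (𝓝 0) := by
  have : Continuous (fun x => 1 - Real.exp (-s * x)) := by fun_prop
  have := this.tendsto 0
  simp only [mul_zero, Real.exp_zero, sub_self] at this
  exact this.mono_left nhdsWithin_le_nhds

lemma tb_expf {s : ℝ} (hs : 0 ≤ s) : TB s (fun x => 1 - Real.exp (-s * x)) := by
  refine TB.of_deriv (fun x _ => expf_deriv s x) (fun x hx => ?_) (expf_zero s)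
  rw [abs_of_nonneg (by positivity)]
  have := exp_neg_mul_le_one hs hx.le
  nlinarith

lemma memE1_expf {s : ℝ} (hs : 0 < s) : MemE1 (fun x => 1 - Real.exp (-s * x)) := by
  have hder : deriv (fun x => 1 - Real.exp (-s * x)) = fun x => s * Real.exp (-s * x) := by
    ext x; exact (expf_deriv s x).deriv
  have hlim : Tendsto (fun x => Real.exp (-s * x)) atTop (𝓝 0) := by
    refine Real.tendsto_exp_atBot.comp ?_
    exact tendsto_id.const_mul_atTop_of_neg (by linarith)
  unfold MemE1
  rw [hder]
  refine ⟨fun x _ => expf_deriv s x, by fun_prop, by fun_prop, expf_zero s, ?_, ?_, ?_, ?_⟩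
  · have : Continuous (fun x => s * Real.exp (-s * x)) := by fun_prop
    exact ⟨_, (this.tendsto 0).mono_left nhdsWithin_le_nhds⟩
  · exact ⟨_, hlim.const_sub 1⟩
  · exact ⟨_, hlim.const_mul s⟩
  · refine ⟨s, s, hs, fun x hx => ?_⟩
    rw [abs_of_nonneg (by positivity)]

namespace Good
variable {ν : Measure ℝ}

lemma prod_restr (h : Good ν) : (ν.prod ν).restrict (Ioi 0 ×ˢ Ioi 0) = ν.prod ν := by
  have := h.sigmaFinite
  rw [← Measure.prod_restrict, h.restr]

lemma aesm (h : Good ν) {ε : ℝ} {f : ℝ → ℝ} (hf : TB ε f) : AEStronglyMeasurable f ν := by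
  have := hf.cont.aestronglyMeasurable (μ := ν) measurableSet_Ioi
  rwa [h.restr] at this

lemma integrable_tb (h : Good ν) {ε : ℝ} {f : ℝ → ℝ} (hf : TB ε f) : Integrable f ν :=
  h.integrable_of (h.aesm hf) hf.b1

lemma integral_tb (h : Good ν) {ε : ℝ} {f : ℝ → ℝ} (hf : TB ε f) :
    |∫ x, f x ∂ν| ≤ ε * mass ν := h.abs_integral_le hf.b1

lemma int_xy (h : Good ν) : Integrable (fun p : ℝ × ℝ => p.1 * p.2) (ν.prod ν) := by
  have := h.sigmaFinite
  exact h.int.mul_prod h.int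

lemma ae_prod (h : Good ν) : ∀ᵐ p ∂(ν.prod ν), 0 < p.1 ∧ 0 < p.2 := by
  rw [← h.prod_restr, ae_restrict_iff' (measurableSet_Ioi.prod measurableSet_Ioi)]
  exact ae_of_all _ fun p hp => hp

lemma integrand_bd {ε : ℝ} {f : ℝ → ℝ} (hf : TB ε f) {p : ℝ × ℝ} (h1 : 0 < p.1) (h2 : 0 < p.2) :
    ‖integrand f p‖ ≤ 4 * ε * (p.1 * p.2) := by
  have a1 := hf.b1 _ h1
  have a2 := hf.b1 _ h2
  have a3 := hf.b2 _ _ h1 h2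
  have a4 := hf.b2 _ _ h2 h1
  rw [add_comm] at a4
  have b1 : |f (p.1 + p.2) - f p.1 - f p.2| ≤ 2 * (ε * p.2) := by
    calc _ ≤ |f (p.1 + p.2) - f p.1| + |f p.2| := abs_sub _ _
      _ ≤ _ := by linarith
  have b2 : |f (p.1 + p.2) - f p.1 - f p.2| ≤ 2 * (ε * p.1) := by
    calc _ = |(f (p.1 + p.2) - f p.2) - f p.1| := by ring_nf
      _ ≤ |f (p.1 + p.2) - f p.2| + |f p.1| := abs_sub _ _
      _ ≤ _ := by linarith
  rw [integrand, norm_mul, Real.norm_eq_abs, Real.norm_eq_abs, abs_of_pos (add_pos h1 h2), mul_add]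
  have c1 := mul_le_mul_of_nonneg_right b1 h1.le
  have c2 := mul_le_mul_of_nonneg_right b2 h2.le
  linarith

lemma integrable_integrand (h : Good ν) {ε : ℝ} {f : ℝ → ℝ} (hf : TB ε f) :
    Integrable (integrand f) (ν.prod ν) := by
  refine (h.int_xy.const_mul (4 * ε)).mono' ?_ (h.ae_prod.mono fun p hp => integrand_bd hf hp.1 hp.2)
  rw [← h.prod_restr]
  refine ContinuousOn.aestronglyMeasurable ?_ (measurableSet_Ioi.prod measurableSet_Ioi)
  have c1 : ContinuousOn (fun p : ℝ × ℝ => f (p.1 + p.2)) (Ioi 0 ×ˢ Ioi 0) :=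
    hf.cont.comp (by fun_prop) fun p hp => mem_Ioi.2 (add_pos (mem_Ioi.1 hp.1) (mem_Ioi.1 hp.2))
  have c2 : ContinuousOn (fun p : ℝ × ℝ => f p.1) (Ioi 0 ×ˢ Ioi 0) :=
    hf.cont.comp (by fun_prop) fun p hp => hp.1
  have c3 : ContinuousOn (fun p : ℝ × ℝ => f p.2) (Ioi 0 ×ˢ Ioi 0) :=
    hf.cont.comp (by fun_prop) fun p hp => hp.2
  exact ((c1.sub c2).sub c3).mul (by fun_prop)

lemma pair_eq (h : Good ν) (f : ℝ → ℝ) : pair ν f = (1/2) * ∫ p, integrand f p ∂(ν.prod ν) := by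
  rw [pair, coagPairing, h.prod_restr]

lemma pair_le (h : Good ν) {ε : ℝ} {f : ℝ → ℝ} (hf : TB ε f) :
    |pair ν f| ≤ 2 * ε * mass ν ^ 2 := by
  have := h.sigmaFinite
  have h1 : ‖∫ p, integrand f p ∂(ν.prod ν)‖ ≤ ∫ p, 4 * ε * (p.1 * p.2) ∂(ν.prod ν) :=
    norm_integral_le_of_norm_le (h.int_xy.const_mul (4 * ε))
      (h.ae_prod.mono fun p hp => integrand_bd hf hp.1 hp.2)
  rw [integral_const_mul, integral_prod_mul (fun x : ℝ => x) (fun x : ℝ => x)] at h1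
  rw [h.pair_eq, abs_mul]
  rw [Real.norm_eq_abs] at h1
  rw [abs_of_pos (by norm_num : (0:ℝ) < 1/2), mass]
  linarith

lemma pair_add (h : Good ν) {a b : ℝ} {f g : ℝ → ℝ} (hf : TB a f) (hg : TB b g) :
    pair ν (fun x => f x + g x) = pair ν f + pair ν g := by
  rw [h.pair_eq, h.pair_eq, h.pair_eq, ← mul_add,
    ← integral_add (h.integrable_integrand hf) (h.integrable_integrand hg)]
  congr 2
  ext p
  simp only [integrand]
  ring

lemma pair_const_mul (h : Good ν) (c : ℝ) (f : ℝ → ℝ) :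
    pair ν (fun x => c * f x) = c * pair ν f := by
  have e : ∫ p, integrand (fun x => c * f x) p ∂(ν.prod ν) =
      c * ∫ p, integrand f p ∂(ν.prod ν) := by
    rw [← integral_const_mul]
    refine integral_congr_ae (ae_of_all _ fun p => ?_)
    simp only [integrand]
    ring
  rw [h.pair_eq, h.pair_eq, e]
  ring

lemma pair_sum (h : Good ν) {n : ℕ} {a : ℕ → ℝ} {g : ℕ → ℝ → ℝ} (hg : ∀ k, TB (a k) (g k)) :
    pair ν (fun x => ∑ k ∈ Finset.range n, g k x) = ∑ k ∈ Finset.range n, pair ν (g k) := by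
  induction n with
  | zero =>
    have := h.pair_const_mul 0 (fun _ => 0)
    simpa using this
  | succ n ih =>
    simp only [Finset.sum_range_succ]
    rw [h.pair_add (TB.sum hg) (hg n), ih]

lemma pair_expf (h : Good ν) {s : ℝ} (hs : 0 ≤ s) :
    pair ν (fun x => 1 - Real.exp (-s * x)) = -(Phi ν s * (mass ν - Dphi ν s)) := by
  have := h.sigmaFinite
  have e : ∀ p : ℝ × ℝ, integrand (fun x => 1 - Real.exp (-s * x)) p =
      -((p.1 * (1 - Real.exp (-s * p.1))) * (1 - Real.exp (-s * p.2)) +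
      (1 - Real.exp (-s * p.1)) * (p.2 * (1 - Real.exp (-s * p.2)))) := by
    intro p
    have : Real.exp (-s * (p.1 + p.2)) = Real.exp (-s * p.1) * Real.exp (-s * p.2) := by
      rw [← Real.exp_add]; ring_nf
    simp only [integrand, this]
    ring
  rw [h.pair_eq]
  simp only [e]
  rw [integral_neg, integral_add ((h.int_aux hs).mul_prod (h.int_phi hs))
    ((h.int_phi hs).mul_prod (h.int_aux hs)),
    integral_prod_mul (fun x : ℝ => x * (1 - Real.exp (-s * x))) (fun x : ℝ => 1 - Real.exp (-s * x)),
    integral_prod_mul (fun x : ℝ => 1 - Real.exp (-s * x)) (fun x : ℝ => x * (1 - Real.exp (-s * x))),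
    h.integral_aux hs, Phi]
  ring

end Good

/-! ### Density of exponential sums in the space of test functions -/

def expSum (n : ℕ) (c : ℕ → ℝ) (x : ℝ) : ℝ :=
  ∑ k ∈ Finset.range n, c k * (1 - Real.exp (-((k:ℝ) + 1) * x))

lemma expSum_tb (n : ℕ) (c : ℕ → ℝ) : ∃ C, TB C (expSum n c) :=
  ⟨_, TB.sum fun k => (tb_expf (s := (k:ℝ) + 1) (by positivity)).const_mul (c k)⟩

lemma Good.integral_expSum {ν : Measure ℝ} (h : Good ν) (n : ℕ) (c : ℕ → ℝ) :
    ∫ x, expSum n c x ∂ν = ∑ k ∈ Finset.range n, c k * Phi ν ((k:ℝ) + 1) := by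
  unfold expSum
  rw [integral_finsetSum]
  · refine Finset.sum_congr rfl fun k _ => ?_
    rw [integral_const_mul, Phi]
  · intro k _
    exact (h.int_phi (by positivity)).const_mul _

lemma Good.pair_expSum {ν : Measure ℝ} (h : Good ν) (n : ℕ) (c : ℕ → ℝ) :
    pair ν (expSum n c) = ∑ k ∈ Finset.range n,
      c k * -(Phi ν ((k:ℝ) + 1) * (mass ν - Dphi ν ((k:ℝ) + 1))) := by
  have := h.pair_sum (n := n) (fun k => (tb_expf (s := (k:ℝ) + 1) (by positivity)).const_mul (c k))
  unfold expSum
  rw [this]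
  refine Finset.sum_congr rfl fun k _ => ?_
  rw [h.pair_const_mul, h.pair_expf (by positivity)]

theorem density {f : ℝ → ℝ} (hf : MemE1 f) {ε : ℝ} (hε : 0 < ε) :
    ∃ n c, TB ε (fun x => f x - expSum n c x) := by
  obtain ⟨hd, -, hc', h0, ⟨L, hL⟩, -, -, C, α, hα, hb⟩ := hf
  set q : ℝ → ℝ := fun u => deriv f (-Real.log u) with hq
  have hqc : ContinuousOn q (Ioo 0 1) := by
    refine hc'.comp (ContinuousOn.neg (Real.continuousOn_log.mono fun x hx => hx.1.ne')) ?_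
    intro u hu
    have := Real.log_neg hu.1 hu.2
    exact neg_pos.2 this
  have hda : Tendsto (deriv f) atTop (𝓝 0) := by
    have hlim : Tendsto (fun x => C * Real.exp (-α * x)) atTop (𝓝 0) := by
      have : Tendsto (fun x => Real.exp (-α * x)) atTop (𝓝 0) := by
        refine Real.tendsto_exp_atBot.comp ?_
        exact tendsto_id.const_mul_atTop_of_neg (by linarith)
      simpa using this.const_mul C
    refine squeeze_zero_norm' ?_ hlim
    filter_upwards [eventually_gt_atTop 0] with x hx
    exact hb x hx
  have hq0 : Tendsto q (𝓝[>] 0) (𝓝 0) :=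
    hda.comp (tendsto_neg_atBot_atTop.comp Real.tendsto_log_nhdsGT_zero)
  have hq1 : Tendsto q (𝓝[<] 1) (𝓝 L) := by
    refine hL.comp (tendsto_nhdsWithin_iff.2 ⟨?_, ?_⟩)
    · have : Tendsto (fun u => -Real.log u) (𝓝 1) (𝓝 (-Real.log 1)) :=
        (Real.continuousAt_log one_ne_zero).neg
      rw [Real.log_one, neg_zero] at this
      exact this.mono_left nhdsWithin_le_nhds
    · filter_upwards [Ioo_mem_nhdsLT (zero_lt_one (α := ℝ))] with u hu
      exact neg_pos.2 (Real.log_neg hu.1 hu.2)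
  have hE := continuousOn_Icc_extendFrom_Ioo hqc hq0 hq1
  have hE0 := eq_lim_at_left_extendFrom_Ioo (zero_lt_one (α := ℝ)) hq0
  have hEi : ∀ u ∈ Ioo (0:ℝ) 1, extendFrom (Ioo 0 1) q u = q u := fun u hu =>
    extendFrom_eq (subset_closure hu) (hqc u hu)
  obtain ⟨p, hp⟩ := exists_polynomial_near_of_continuousOn 0 1 _ hE (ε / 2) (by positivity)
  have hp0 := hp 0 (by simp)
  rw [hE0, sub_zero] at hp0
  refine ⟨p.divX.natDegree + 1, fun k => p.divX.coeff k / ((k:ℝ) + 1), ?_⟩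
  have hder : ∀ x, 0 < x → HasDerivAt (fun x => f x - expSum (p.divX.natDegree + 1)
      (fun k => p.divX.coeff k / ((k:ℝ) + 1)) x)
      (deriv f x - (p.eval (Real.exp (-x)) - p.eval 0)) x := by
    intro x hx
    refine (hd x hx).sub ?_
    unfold expSum
    have h1 := HasDerivAt.fun_sum (u := Finset.range (p.divX.natDegree + 1)) (x := x)
      (A := fun k x => p.divX.coeff k / ((k:ℝ) + 1) * (1 - Real.exp (-((k:ℝ) + 1) * x)))
      (fun k _ => (expf_deriv ((k:ℝ) + 1) x).const_mul _)
    refine h1.congr_deriv ?_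
    have h2 : p.eval (Real.exp (-x)) - p.eval 0 = p.divX.eval (Real.exp (-x)) * Real.exp (-x) := by
      conv_lhs => rw [← Polynomial.divX_mul_X_add p]
      simp
    rw [h2, Polynomial.eval_eq_sum_range, Finset.sum_mul]
    refine Finset.sum_congr rfl fun k _ => ?_
    have h3 : Real.exp (-((k:ℝ) + 1) * x) = Real.exp (-x) ^ k * Real.exp (-x) := by
      rw [← pow_succ, ← Real.exp_nat_mul]
      push_cast
      ring_nf
    rw [h3]
    have : (k:ℝ) + 1 ≠ 0 := by positivity
    field_simp
  refine TB.of_deriv hder (fun x hx => ?_) ?_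
  · have hu : Real.exp (-x) ∈ Ioo (0:ℝ) 1 := ⟨Real.exp_pos _, by simpa using hx⟩
    have h1 := hp _ (Ioo_subset_Icc_self hu)
    rw [hEi _ hu] at h1
    simp only [hq, Real.log_exp, neg_neg] at h1
    calc |deriv f x - (p.eval (Real.exp (-x)) - p.eval 0)|
        = |-(p.eval (Real.exp (-x)) - deriv f x) + p.eval 0| := by ring_nf
      _ ≤ |-(p.eval (Real.exp (-x)) - deriv f x)| + |p.eval 0| := abs_add_le _ _
      _ ≤ ε / 2 + ε / 2 := by rw [abs_neg]; exact add_le_add h1.le hp0.le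
      _ = ε := by ring
  · have hs : Continuous (expSum (p.divX.natDegree + 1)
      (fun k => p.divX.coeff k / ((k:ℝ) + 1))) := by
      unfold expSum; fun_prop
    have := (hs.tendsto 0).mono_left (nhdsWithin_le_nhds (s := Ioi 0))
    have h2 := h0.sub this
    simpa [expSum] using h2

/-! ### Cut-offs, separation of measures, measurability -/

def cutoff (b : ℝ) (n : ℕ) (x : ℝ) : ℝ := Real.smoothTransition (((n:ℝ) + 1) * (x - b))

lemma cutoff_zero {b x : ℝ} (n : ℕ) (hx : x ≤ b) : cutoff b n x = 0 := by
  refine Real.smoothTransition.zero_of_nonpos ?_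
  have : (0:ℝ) ≤ (n:ℝ) + 1 := by positivity
  nlinarith

lemma cutoff_one {b x : ℝ} (n : ℕ) (hx : 1 ≤ ((n:ℝ) + 1) * (x - b)) : cutoff b n x = 1 :=
  Real.smoothTransition.one_of_one_le hx

lemma cutoff_contDiff (b : ℝ) (n : ℕ) : ContDiff ℝ 1 (cutoff b n) := by
  unfold cutoff
  exact Real.smoothTransition.contDiff.comp (by fun_prop)

lemma cutoff_memE1 {b : ℝ} (hb : 0 < b) (n : ℕ) : MemE1 (cutoff b n) := by
  have hcd := cutoff_contDiff b n
  have hc' : Continuous (deriv (cutoff b n)) := hcd.continuous_deriv le_rfl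
  have hc := hcd.continuous
  have hone : ∀ x, b + 1 ≤ x → cutoff b n x = 1 := fun x hx => by
    refine cutoff_one n ?_
    have : (0:ℝ) ≤ n := by positivity
    nlinarith
  have hd1 : ∀ x, b + 1 < x → deriv (cutoff b n) x = 0 := by
    intro x hx
    have : cutoff b n =ᶠ[𝓝 x] fun _ => 1 := by
      filter_upwards [Ioi_mem_nhds hx] with y hy
      exact hone y (le_of_lt hy)
    rw [this.deriv_eq, deriv_const]
  obtain ⟨K, hK⟩ := (isCompact_Icc (a := 0) (b := b + 1)).exists_bound_of_continuousOn
    hc'.continuousOn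
  refine ⟨fun x _ => (hcd.differentiable one_ne_zero x).hasDerivAt, hc.continuousOn,
    hc'.continuousOn, ?_, ⟨_, (hc'.tendsto 0).mono_left nhdsWithin_le_nhds⟩, ⟨1, ?_⟩, ⟨0, ?_⟩,
    K * Real.exp (b + 1), 1, one_pos, fun x hx => ?_⟩
  · have := (hc.tendsto 0).mono_left (nhdsWithin_le_nhds (s := Ioi 0))
    rwa [cutoff_zero n hb.le] at this
  · refine tendsto_const_nhds.congr' ?_
    filter_upwards [eventually_ge_atTop (b + 1)] with x hx
    exact (hone x hx).symm
  · refine tendsto_const_nhds.congr' ?_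
    filter_upwards [eventually_gt_atTop (b + 1)] with x hx
    exact (hd1 x hx).symm
  · have hK0 : 0 ≤ K := (norm_nonneg _).trans (hK 0 ⟨le_rfl, by positivity⟩)
    rcases lt_or_ge (b + 1) x with h | h
    · rw [hd1 x h, abs_zero]
      positivity
    · have h1 := hK x ⟨hx.le, h⟩
      rw [Real.norm_eq_abs] at h1
      have h2 : 1 ≤ Real.exp (b + 1) * Real.exp (-1 * x) := by
        rw [← Real.exp_add]
        exact Real.one_le_exp (by linarith)
      calc _ ≤ K * 1 := by linarith
        _ ≤ K * (Real.exp (b + 1) * Real.exp (-1 * x)) := by gcongr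
        _ = _ := by ring

lemma Good.measure_Ioi_lt {ν : Measure ℝ} (h : Good ν) {b : ℝ} (hb : 0 < b) : ν (Ioi b) < ⊤ :=
  h.int.measure_gt_lt_top hb

lemma Good.cutoff_tendsto {ν : Measure ℝ} (h : Good ν) {b : ℝ} (hb : 0 < b) :
    Tendsto (fun n => ∫ x, cutoff b n x ∂ν) atTop (𝓝 (ν.real (Ioi b))) := by
  have e : ν.real (Ioi b) = ∫ x, (Ioi b).indicator (fun _ => (1:ℝ)) x ∂ν := by
    rw [integral_indicator measurableSet_Ioi]
    simp
  rw [e]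
  refine tendsto_integral_of_dominated_convergence (fun x => (1 / b) * x)
    (fun n => (cutoff_contDiff b n).continuous.aestronglyMeasurable) (h.int.const_mul _) ?_ ?_
  · intro n
    filter_upwards [h.ae_pos] with x hx
    rw [Real.norm_eq_abs]
    rcases le_or_gt x b with hxb | hxb
    · rw [cutoff_zero n hxb, abs_zero]
      positivity
    · rw [cutoff, abs_of_nonneg (Real.smoothTransition.nonneg _)]
      refine (Real.smoothTransition.le_one _).trans ?_
      rw [one_div, inv_mul_eq_div, one_le_div hb]
      exact hxb.le
  · refine ae_of_all _ fun x => ?_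
    rcases le_or_gt x b with hxb | hxb
    · rw [indicator_of_notMem (by simpa using hxb)]
      exact tendsto_const_nhds.congr fun n => (cutoff_zero n hxb).symm
    · rw [indicator_of_mem (by simpa using hxb)]
      refine tendsto_const_nhds.congr' ?_
      have hx : 0 < x - b := sub_pos.2 hxb
      obtain ⟨m, hm⟩ := exists_nat_ge (1 / (x - b))
      filter_upwards [eventually_ge_atTop m] with n hn
      refine (cutoff_one n ?_).symm
      rw [← div_le_iff₀ hx]
      have : (m:ℝ) ≤ n := by exact_mod_cast hn
      linarith

lemma iUnion_Ioi_inv : ⋃ n : ℕ, Ioi (1 / ((n:ℝ) + 1)) = Ioi (0:ℝ) := by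
  ext x
  simp only [mem_iUnion, mem_Ioi]
  constructor
  · rintro ⟨n, hn⟩
    exact lt_trans (by positivity) hn
  · intro hx
    exact exists_nat_one_div_lt hx

theorem Good.ext_of_integral {μ ν : Measure ℝ} (hμ : Good μ) (hν : Good ν)
    (h : ∀ f, MemE1 f → ∫ x, f x ∂μ = ∫ x, f x ∂ν) : μ = ν := by
  have hI : ∀ b, 0 < b → μ (Ioi b) = ν (Ioi b) := by
    intro b hb
    have h1 := hμ.cutoff_tendsto hb
    have h2 := hν.cutoff_tendsto hb
    simp only [fun n => h _ (cutoff_memE1 hb n)] at h1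
    have := tendsto_nhds_unique h1 h2
    exact (measureReal_eq_measureReal_iff (hμ.measure_Ioi_lt hb).ne (hν.measure_Ioi_lt hb).ne).1 this
  rw [← hμ.restr, ← hν.restr, ← iUnion_Ioi_inv, Measure.restrict_iUnion_congr]
  intro n
  have hb : (0:ℝ) < 1 / ((n:ℝ) + 1) := by positivity
  have : IsFiniteMeasure (μ.restrict (Ioi (1 / ((n:ℝ) + 1)))) :=
    ⟨by rw [Measure.restrict_apply_univ]; exact hμ.measure_Ioi_lt hb⟩
  refine ext_of_generate_finite (range Ioi) (by rw [← borel_eq_generateFrom_Ioi]; exact BorelSpace.measurable_eq) isPiSystem_Ioi ?_ ?_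
  · rintro _ ⟨a, rfl⟩
    rw [Measure.restrict_apply measurableSet_Ioi, Measure.restrict_apply measurableSet_Ioi,
      Ioi_inter_Ioi]
    exact hI _ (hb.trans_le le_sup_right)
  · rw [Measure.restrict_apply_univ, Measure.restrict_apply_univ]
    exact hI _ hb

theorem Good.ext_of_phi {μ ν : Measure ℝ} (hμ : Good μ) (hν : Good ν)
    (h : ∀ s, 0 < s → Phi μ s = Phi ν s) : μ = ν := by
  refine hμ.ext_of_integral hν fun f hf => ?_
  obtain ⟨C, hfC⟩ := hf.tb
  have hm : 0 ≤ mass μ + mass ν := add_nonneg hμ.mass_nonneg hν.mass_nonneg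
  refine eq_of_forall_dist_le fun δ hδ => ?_
  have hε : 0 < δ / (mass μ + mass ν + 1) := by positivity
  obtain ⟨n, c, hTB⟩ := density hf hε
  obtain ⟨D, hgD⟩ := expSum_tb n c
  have e : ∀ {κ : Measure ℝ}, Good κ → ∫ x, f x ∂κ =
      ∫ x, (f x - expSum n c x) ∂κ + ∫ x, expSum n c x ∂κ := by
    intro κ hκ
    rw [integral_sub (hκ.integrable_tb hfC) (hκ.integrable_tb hgD)]
    ring
  have e2 : ∫ x, expSum n c x ∂μ = ∫ x, expSum n c x ∂ν := by
    rw [hμ.integral_expSum, hν.integral_expSum]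
    exact Finset.sum_congr rfl fun k _ => by rw [h _ (by positivity)]
  rw [Real.dist_eq, e hμ, e hν, e2, add_sub_add_right_eq_sub]
  calc _ ≤ |∫ x, (f x - expSum n c x) ∂μ| + |∫ x, (f x - expSum n c x) ∂ν| := abs_sub _ _
    _ ≤ δ / (mass μ + mass ν + 1) * mass μ + δ / (mass μ + mass ν + 1) * mass ν :=
      add_le_add (hμ.integral_tb hTB) (hν.integral_tb hTB)
    _ = δ / (mass μ + mass ν + 1) * (mass μ + mass ν) := by ring
    _ ≤ δ / (mass μ + mass ν + 1) * (mass μ + mass ν + 1) := mul_le_mul_of_nonneg_left (by linarith) hε.le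
    _ = δ := by field_simp

lemma measurable_of_restrict {κ : ℝ → Measure ℝ} {S : ℕ → Set ℝ} (hS : Monotone S)
    (hSm : ∀ n, MeasurableSet (S n)) (hU : ⋃ n, S n = Ioi 0) (hs : ∀ t, κ t (Iic 0) = 0)
    (h : ∀ n, Measurable fun t => (κ t).restrict (S n)) : Measurable κ := by
  refine Measure.measurable_of_measurable_coe _ fun A hA => ?_
  have e : ∀ t, κ t A = ⨆ n, (κ t).restrict (S n) A := by
    intro t
    have hmono : Monotone fun n => A ∩ S n := fun m n hmn => inter_subset_inter_right _ (hS hmn)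
    conv_lhs => rw [← restrict_of_supp (hs t), Measure.restrict_apply hA, ← hU, inter_iUnion,
      hmono.measure_iUnion]
    simp only [Measure.restrict_apply hA]
  simp only [e]
  exact Measurable.iSup fun n => (Measure.measurable_coe hA).comp (h n)

lemma mono_Ioi_inv : Monotone fun n : ℕ => Ioi (1 / ((n:ℝ) + 1)) := by
  intro m n hmn
  apply Ioi_subset_Ioi
  exact one_div_le_one_div_of_le (by positivity) (by gcongr)

theorem measurable_of_integral {κ : ℝ → Measure ℝ} (hg : ∀ t, Good (κ t))
    (h : ∀ f, MemE1 f → Measurable fun t => ∫ x, f x ∂(κ t)) : Measurable κ := by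
  have hI : ∀ b, 0 < b → Measurable fun t => κ t (Ioi b) := by
    intro b hb
    have : Measurable fun t => (κ t).real (Ioi b) := by
      refine measurable_of_tendsto_metrizable (fun n => h _ (cutoff_memE1 hb n))
        (tendsto_pi_nhds.2 fun t => (hg t).cutoff_tendsto hb)
    convert this.ennreal_ofReal using 1
    ext t
    symm
    exact ENNReal.ofReal_toReal ((hg t).measure_Ioi_lt hb).ne
  refine measurable_of_restrict mono_Ioi_inv (fun n => measurableSet_Ioi) iUnion_Ioi_inv
    (fun t => (hg t).supp) fun n => ?_
  have hb : (0:ℝ) < 1 / ((n:ℝ) + 1) := by positivity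
  have : ∀ t, IsFiniteMeasure ((κ t).restrict (Ioi (1 / ((n:ℝ) + 1)))) := fun t =>
    ⟨by rw [Measure.restrict_apply_univ]; exact (hg t).measure_Ioi_lt hb⟩
  refine Measurable.measure_of_isPiSystem (S := range Ioi) (by rw [← borel_eq_generateFrom_Ioi]; exact BorelSpace.measurable_eq) isPiSystem_Ioi ?_ ?_
  · rintro _ ⟨a, rfl⟩
    simp only [Measure.restrict_apply measurableSet_Ioi, Ioi_inter_Ioi]
    exact hI _ (hb.trans_le le_sup_right)
  · simp only [Measure.restrict_apply_univ]
    exact hI _ hb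

theorem measurable_of_compact {κ : ℝ → Measure ℝ} (hg : ∀ t, Good (κ t))
    (h : ∀ B : Set ℝ, IsCompact B → B ⊆ Ioi 0 → Measurable fun t => (κ t B).toReal) :
    Measurable κ := by
  have hpos : ∀ n : ℕ, (0:ℝ) < 1 / ((n:ℝ) + 1) := fun n => by positivity
  have hfin : ∀ (n : ℕ) t, κ t (Icc (1 / ((n:ℝ) + 1)) (n + 1)) < ⊤ := fun n t =>
    (measure_mono Icc_subset_Ici_self).trans_lt ((hg t).int.measure_ge_lt_top (hpos n))
  refine measurable_of_restrict (S := fun n : ℕ => Icc (1 / ((n:ℝ) + 1)) (n + 1)) ?_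
    (fun n => measurableSet_Icc) ?_ (fun t => (hg t).supp) fun n => ?_
  · intro m n hmn
    refine Icc_subset_Icc (one_div_le_one_div_of_le (by positivity) (by gcongr)) (by gcongr)
  · ext x
    simp only [mem_iUnion, mem_Icc, mem_Ioi]
    constructor
    · rintro ⟨n, hn, -⟩
      exact lt_of_lt_of_le (by positivity) hn
    · intro hx
      obtain ⟨n, hn⟩ := exists_nat_one_div_lt hx
      obtain ⟨m, hm⟩ := exists_nat_ge x
      refine ⟨max n m, ?_, ?_⟩
      · refine le_trans (one_div_le_one_div_of_le (by positivity) ?_) hn.le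
        gcongr
        exact le_max_left _ _
      · have : (m:ℝ) ≤ (max n m : ℕ) := by exact_mod_cast le_max_right _ _
        linarith
  · have : ∀ t, IsFiniteMeasure ((κ t).restrict (Icc (1 / ((n:ℝ) + 1)) (n + 1))) := fun t =>
      ⟨by rw [Measure.restrict_apply_univ]; exact hfin n t⟩
    have key : ∀ C : Set ℝ, IsClosed C →
        Measurable fun t => κ t (C ∩ Icc (1 / ((n:ℝ) + 1)) (n + 1)) := by
      intro C hC
      have := h (C ∩ Icc (1 / ((n:ℝ) + 1)) (n + 1)) (isCompact_Icc.inter_left hC)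
        (fun x hx => (hpos n).trans_le hx.2.1)
      convert this.ennreal_ofReal using 1
      ext t
      symm
      exact ENNReal.ofReal_toReal ((measure_mono inter_subset_right).trans_lt (hfin n t)).ne
    refine Measurable.measure_of_isPiSystem (S := {s | IsClosed s})
      (by rw [← borel_eq_generateFrom_isClosed]; exact BorelSpace.measurable_eq)
      isPiSystem_isClosed ?_ ?_
    · intro C hC
      simp only [Measure.restrict_apply (IsClosed.measurableSet hC)]
      exact key C hC
    · have := key univ isClosed_univ
      simpa only [Measure.restrict_apply_univ, univ_inter] using this

lemma measurable_integral_nonneg {κ : ℝ → Measure ℝ} (hκ : Measurable κ) (hg : ∀ t, Good (κ t))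
    {f : ℝ → ℝ} (hf : Measurable f) (h0 : ∀ x, 0 < x → 0 ≤ f x) :
    Measurable fun t => ∫ x, f x ∂(κ t) := by
  have e : ∀ t, ∫ x, f x ∂(κ t) = (∫⁻ x, ENNReal.ofReal (f x) ∂(κ t)).toReal := fun t =>
    integral_eq_lintegral_of_nonneg_ae ((hg t).ae_pos.mono fun x hx => h0 x hx)
      hf.aestronglyMeasurable
  simp only [e]
  exact ((Measure.measurable_lintegral hf.ennreal_ofReal).comp hκ).ennreal_toReal

lemma measurable_phi {κ : ℝ → Measure ℝ} (hκ : Measurable κ) (hg : ∀ t, Good (κ t))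
    {s : ℝ} (hs : 0 ≤ s) : Measurable fun t => Phi (κ t) s :=
  measurable_integral_nonneg hκ hg (by fun_prop) fun _ hx => one_sub_exp_nonneg hs hx.le

lemma measurable_dphi {κ : ℝ → Measure ℝ} (hκ : Measurable κ) (hg : ∀ t, Good (κ t))
    (s : ℝ) : Measurable fun t => Dphi (κ t) s :=
  measurable_integral_nonneg hκ hg (by fun_prop) fun x hx => by positivity

lemma measurable_mass {κ : ℝ → Measure ℝ} (hκ : Measurable κ) (hg : ∀ t, Good (κ t)) :
    Measurable fun t => mass (κ t) :=
  measurable_integral_nonneg hκ hg (by fun_prop) fun x hx => hx.le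

/-! ### Existence -/

lemma cont_of_approx {F : ℝ → ℝ} (h : ∀ δ > 0, ∃ G : ℝ → ℝ, Continuous G ∧ ∀ t, |F t - G t| ≤ δ) :
    Continuous F := by
  refine continuous_of_uniform_approx_of_continuous fun u hu => ?_
  obtain ⟨δ, hδ, hu'⟩ := Metric.mem_uniformity_dist.1 hu
  obtain ⟨G, hG, hb⟩ := h (δ / 2) (by positivity)
  refine ⟨G, hG, fun t => hu' ?_⟩
  rw [Real.dist_eq]
  exact (hb t).trans_lt (by linarith)

structure SolFam (ν : Measure ℝ) (N : ℝ → Measure ℝ) : Prop where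
  good0 : Good ν
  good : ∀ t, Good (N t)
  mass : ∀ t, mass (N t) = mass ν
  pc : ∀ s, 0 < s → Continuous fun t => Phi (N t) s
  dc : ∀ s, 0 < s → Continuous fun t => Dphi (N t) s
  evol : ∀ s t, 0 < s → 0 ≤ t →
    Phi (N t) s = Phi ν s + ∫ τ in (0:ℝ)..t, -(Phi (N τ) s * (_root_.mass ν - Dphi (N τ) s))

namespace SolFam
variable {ν : Measure ℝ} {N : ℝ → Measure ℝ}

lemma integral_split {κ : Measure ℝ} (h : Good κ) {f : ℝ → ℝ} (hf : MemE1 f) (n : ℕ) (c : ℕ → ℝ) :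
    ∫ x, f x ∂κ = ∫ x, (f x - expSum n c x) ∂κ + ∫ x, expSum n c x ∂κ := by
  obtain ⟨C, hfC⟩ := hf.tb
  obtain ⟨D, hgD⟩ := expSum_tb n c
  rw [integral_sub (h.integrable_tb hfC) (h.integrable_tb hgD)]
  ring

lemma pair_split {κ : Measure ℝ} (h : Good κ) {f : ℝ → ℝ} {n : ℕ} {c : ℕ → ℝ} {ε : ℝ}
    (hTB : TB ε (fun x => f x - expSum n c x)) :
    pair κ f = pair κ (fun x => f x - expSum n c x) + pair κ (expSum n c) := by
  obtain ⟨D, hgD⟩ := expSum_tb n c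
  rw [← h.pair_add hTB hgD]
  congr 1
  ext x
  ring

lemma cont_int_sum (h : SolFam ν N) (n : ℕ) (c : ℕ → ℝ) :
    Continuous fun t => ∫ x, expSum n c x ∂(N t) := by
  simp only [fun t => (h.good t).integral_expSum n c]
  exact continuous_finsetSum _ fun k _ => (h.pc _ (by positivity)).const_mul _

lemma cont_pair_sum (h : SolFam ν N) (n : ℕ) (c : ℕ → ℝ) :
    Continuous fun t => pair (N t) (expSum n c) := by
  simp only [fun t => (h.good t).pair_expSum n c, h.mass]
  refine continuous_finsetSum _ fun k _ => ?_
  have h1 := h.pc ((k:ℝ) + 1) (by positivity)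
  have h2 := h.dc ((k:ℝ) + 1) (by positivity)
  fun_prop

lemma cont_int (h : SolFam ν N) {f : ℝ → ℝ} (hf : MemE1 f) :
    Continuous fun t => ∫ x, f x ∂(N t) := by
  refine cont_of_approx fun δ hδ => ?_
  have hm := h.good0.mass_nonneg
  obtain ⟨n, c, hTB⟩ := density hf (ε := δ / (_root_.mass ν + 1)) (by positivity)
  refine ⟨_, h.cont_int_sum n c, fun t => ?_⟩
  rw [integral_split (h.good t) hf n c, add_sub_cancel_right]
  refine ((h.good t).integral_tb hTB).trans ?_
  rw [h.mass, div_mul_eq_mul_div, div_le_iff₀ (by positivity)]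
  nlinarith

lemma cont_pair (h : SolFam ν N) {f : ℝ → ℝ} (hf : MemE1 f) :
    Continuous fun t => pair (N t) f := by
  refine cont_of_approx fun δ hδ => ?_
  have hm := h.good0.mass_nonneg
  obtain ⟨n, c, hTB⟩ := density hf (ε := δ / (2 * _root_.mass ν ^ 2 + 1)) (by positivity)
  refine ⟨_, h.cont_pair_sum n c, fun t => ?_⟩
  rw [pair_split (h.good t) hTB, add_sub_cancel_right]
  refine ((h.good t).pair_le hTB).trans ?_
  rw [h.mass]
  have : 2 * (δ / (2 * _root_.mass ν ^ 2 + 1)) * _root_.mass ν ^ 2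
    = δ * (2 * _root_.mass ν ^ 2) / (2 * _root_.mass ν ^ 2 + 1) := by ring
  rw [this, div_le_iff₀ (by positivity)]
  nlinarith

lemma weak_sum (h : SolFam ν N) (n : ℕ) (c : ℕ → ℝ) {t : ℝ} (ht : 0 ≤ t) :
    ∫ x, expSum n c x ∂(N t) = ∫ x, expSum n c x ∂ν +
      ∫ τ in (0:ℝ)..t, pair (N τ) (expSum n c) := by
  simp only [fun t => (h.good t).pair_expSum n c, h.mass]
  rw [(h.good t).integral_expSum, h.good0.integral_expSum, intervalIntegral.integral_finsetSum,
    ← Finset.sum_add_distrib]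
  · refine Finset.sum_congr rfl fun k _ => ?_
    rw [h.evol _ t (by positivity) ht, intervalIntegral.integral_const_mul]
    ring
  · intro k _
    have h1 := h.pc ((k:ℝ) + 1) (by positivity)
    have h2 := h.dc ((k:ℝ) + 1) (by positivity)
    exact Continuous.intervalIntegrable (by fun_prop) _ _

lemma weak (h : SolFam ν N) {f : ℝ → ℝ} (hf : MemE1 f) {t : ℝ} (ht : 0 ≤ t) :
    ∫ x, f x ∂(N t) = ∫ x, f x ∂ν + ∫ τ in (0:ℝ)..t, pair (N τ) f := by
  refine eq_of_forall_dist_le fun δ hδ => ?_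
  have hm := h.good0.mass_nonneg
  set M := _root_.mass ν with hM
  have hK : 0 < 2 * M + 2 * M ^ 2 * t + 1 := by positivity
  set ε := δ / (2 * M + 2 * M ^ 2 * t + 1) with hε
  obtain ⟨n, c, hTB⟩ := density hf (ε := ε) (by positivity)
  have hw := h.weak_sum n c ht
  have hpe : ∀ τ, pair (N τ) (fun x => f x - expSum n c x)
      = pair (N τ) f - pair (N τ) (expSum n c) := by
    intro τ
    have := pair_split (h.good τ) hTB
    linarith
  have h3 : |∫ τ in (0:ℝ)..t, pair (N τ) (fun x => f x - expSum n c x)| ≤ 2 * ε * M ^ 2 * |t - 0| := by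
    refine intervalIntegral.norm_integral_le_of_norm_le_const (C := 2 * ε * M ^ 2)
      (f := fun τ => pair (N τ) (fun x => f x - expSum n c x)) fun τ _ => ?_
    have := (h.good τ).pair_le hTB
    rwa [h.mass] at this
  have h4 : ∫ τ in (0:ℝ)..t, pair (N τ) (fun x => f x - expSum n c x) =
      (∫ τ in (0:ℝ)..t, pair (N τ) f) - ∫ τ in (0:ℝ)..t, pair (N τ) (expSum n c) := by
    simp only [hpe]
    exact intervalIntegral.integral_sub ((h.cont_pair hf).intervalIntegrable _ _)
      ((h.cont_pair_sum n c).intervalIntegrable _ _)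
  have h1 := (h.good t).integral_tb hTB
  have h2 := h.good0.integral_tb hTB
  rw [h.mass] at h1
  rw [sub_zero, abs_of_nonneg ht] at h3
  rw [Real.dist_eq, integral_split (h.good t) hf n c, integral_split h.good0 hf n c, hw]
  have e : ∫ x, (f x - expSum n c x) ∂(N t) + (∫ x, expSum n c x ∂ν +
      ∫ τ in (0:ℝ)..t, pair (N τ) (expSum n c)) - (∫ x, (f x - expSum n c x) ∂ν +
      ∫ x, expSum n c x ∂ν + ∫ τ in (0:ℝ)..t, pair (N τ) f) =
      ∫ x, (f x - expSum n c x) ∂(N t) - ∫ x, (f x - expSum n c x) ∂ν -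
      ∫ τ in (0:ℝ)..t, pair (N τ) (fun x => f x - expSum n c x) := by
    rw [h4]; ring
  rw [e]
  have hb : ε * M + ε * M + 2 * ε * M ^ 2 * t ≤ δ := by
    have : ε * M + ε * M + 2 * ε * M ^ 2 * t = δ * (2 * M + 2 * M ^ 2 * t) /
        (2 * M + 2 * M ^ 2 * t + 1) := by rw [hε]; ring
    rw [this, div_le_iff₀ hK]
    nlinarith
  refine le_trans ?_ hb
  refine (abs_sub _ _).trans (add_le_add ((abs_sub _ _).trans (add_le_add h1 h2)) h3)

theorem isSolution (h : SolFam ν N) : IsCoagSolutionAdd ν N := by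
  refine ⟨fun t _ => (h.good t).supp, fun B hB _ => ?_, fun t _ => ?_, fun f hf t ht => ⟨?_, ?_, ?_, ?_⟩⟩
  · have := measurable_of_integral h.good fun f hf => (h.cont_int hf).measurable
    exact ((Measure.measurable_coe hB.measurableSet).comp this).ennreal_toReal
  · simp only [fun τ => (h.good τ).massMoment_eq, h.mass]
    exact integrableOn_const (by simp) 
  · intro τ _
    obtain ⟨C, hC⟩ := hf.tb
    exact ((h.good τ).integrable_integrand hC).integrableOn
  · obtain ⟨C, hC⟩ := hf.tb
    exact ((h.good t).integrable_tb hC).integrableOn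
  · obtain ⟨C, hC⟩ := hf.tb
    exact (h.good0.integrable_tb hC).integrableOn
  · rw [(h.good t).restr, h.good0.restr]
    exact h.weak hf ht

end SolFam

/-! ### Uniqueness at the level of Laplace exponents -/

lemma Good.phi_taylor {ν : Measure ℝ} (h : Good ν) {d s s' : ℝ} (hd : 0 < d) (hs : d ≤ s)
    (hs' : d ≤ s') : |Phi ν s' - Phi ν s - Dphi ν s * (s' - s)| ≤ mass ν / d * |s' - s| * |s' - s| := by
  have hsub : ∀ z ∈ uIcc s s', d ≤ z := fun z hz => le_trans (le_min hs hs') hz.1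
  have hm := h.mass_nonneg
  have := (convex_uIcc s s').norm_image_sub_le_of_norm_hasDerivWithin_le
    (f := fun z => Phi ν z - Dphi ν s * z) (f' := fun z => Dphi ν z - Dphi ν s * 1)
    (C := mass ν / d * |s' - s|)
    (fun z hz => ((h.hasDerivAt_phi (hd.trans_le (hsub z hz))).sub
      ((hasDerivAt_id z).const_mul _)).hasDerivWithinAt)
    (fun z hz => ?_) left_mem_uIcc right_mem_uIcc
  · rw [Real.norm_eq_abs, Real.norm_eq_abs] at this
    refine le_trans (le_of_eq ?_) this
    congr 1
    ring
  · rw [mul_one, Real.norm_eq_abs]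
    refine (h.dphi_lip hd hs (hsub z hz)).trans ?_
    have := abs_sub_left_of_mem_uIcc hz
    gcongr

namespace SolFam
variable {ν : Measure ℝ} {N : ℝ → Measure ℝ}

lemma phi_hasDeriv (h : SolFam ν N) {s t : ℝ} (hs : 0 < s) (ht : 0 ≤ t) :
    HasDerivWithinAt (fun r => Phi (N r) s) (-(Phi (N t) s * (_root_.mass ν - Dphi (N t) s)))
      (Ioi t) t := by
  have h1 := h.pc s hs
  have h2 := h.dc s hs
  have hc : Continuous fun τ => -(Phi (N τ) s * (_root_.mass ν - Dphi (N τ) s)) := by fun_prop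
  have hd := intervalIntegral.integral_hasDerivAt_right (hc.intervalIntegrable 0 t)
    hc.aestronglyMeasurable.stronglyMeasurableAtFilter hc.continuousAt
  have := (hd.const_add (Phi ν s)).hasDerivWithinAt (s := Ioi t)
  refine this.congr (fun r hr => h.evol s r hs (ht.trans (le_of_lt hr))) (h.evol s t hs ht)

theorem phi_formula (h : SolFam ν N) {s t : ℝ} (hs : 0 < s) (ht : 0 ≤ t) :
    Phi (N t) s = Real.exp (-_root_.mass ν * t) * Phi ν (PsiT ν t s) := by
  set M := _root_.mass ν with hM
  have hM0 : 0 ≤ M := h.good0.mass_nonneg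
  set s₀ := PsiT ν t s with hs₀
  have hs₀p : 0 < s₀ := hs.trans_le (PsiT_ge h.good0 ht hs.le)
  set ch : ℝ → ℝ := fun r => s₀ - aT M r * Phi ν s₀ with hch
  have hcht : ch t = s := by
    have := PsiT_fix h.good0 ht hs.le
    simp only [hch]
    rw [← hs₀] at this
    linarith
  have hchd : ∀ r, HasDerivAt ch (-(Real.exp (-M * r) * Phi ν s₀)) r := fun r =>
    ((aT_hasDerivAt M r).mul_const _).const_sub _
  have hchp : ∀ r, 0 ≤ r → 0 < ch r := by
    intro r hr
    have h1 := mul_le_mul_of_nonneg_left (h.good0.phi_le hs₀p.le) (aT_nonneg M hr)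
    have h2 : aT M r * (M * s₀) = (1 - Real.exp (-M * r)) * s₀ := by
      rw [← aT_mul]; ring
    have h3 := mul_pos (Real.exp_pos (-M * r)) hs₀p
    simp only [hch]
    rw [← hM, h2] at h1
    linarith
  have hchc : Continuous ch := continuous_iff_continuousAt.2 fun r => (hchd r).continuousAt
  set v : ℝ → ℝ := fun r => Real.exp (-M * r) * Phi ν s₀ with hv
  have hvd : ∀ r, HasDerivAt v (-M * v r) r := by
    intro r
    have := (((hasDerivAt_id r).const_mul (-M)).exp).mul_const (Phi ν s₀)
    refine this.congr_deriv ?_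
    simp only [id, mul_one, hv]
    ring
  have hlow : ∀ r₀, 0 ≤ r₀ → ∀ᶠ r in 𝓝 r₀, ch r₀ / 2 ≤ ch r := by
    intro r₀ hr₀
    have := hchc.continuousAt.eventually (Ioi_mem_nhds (half_lt_self (hchp r₀ hr₀)))
    filter_upwards [this] with r hr using le_of_lt hr
  -- continuity
  have hucont : ContinuousOn (fun r => Phi (N r) (ch r) - v r) (Icc 0 t) := by
    intro r₀ hr₀
    refine ContinuousAt.continuousWithinAt ?_
    refine ContinuousAt.sub ?_ (hvd r₀).continuousAt
    have hp := hchp r₀ hr₀.1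
    have hT : Tendsto (fun r => (Phi (N r) (ch r) - Phi (N r) (ch r₀)) + Phi (N r) (ch r₀)) (𝓝 r₀)
        (𝓝 (0 + Phi (N r₀) (ch r₀))) := by
      refine Tendsto.add ?_ ((h.pc _ hp).tendsto r₀)
      have hz : Tendsto (fun r => M * |ch r - ch r₀|) (𝓝 r₀) (𝓝 0) := by
        have : Continuous (fun r => M * |ch r - ch r₀|) := by fun_prop
        have := this.tendsto r₀
        simpa using this
      refine squeeze_zero_norm' ?_ hz
      filter_upwards [hlow r₀ hr₀.1] with r hr
      have := (h.good r).phi_lip hp.le (le_trans (by positivity) hr)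
      rwa [h.mass] at this
    simpa [ContinuousAt] using hT
  -- derivative
  have huder : ∀ r₀ ∈ Ico 0 t, HasDerivWithinAt (fun r => Phi (N r) (ch r) - v r)
      ((Dphi (N r₀) (ch r₀) - M) * (Phi (N r₀) (ch r₀) - v r₀)) (Ici r₀) r₀ := by
    intro r₀ hr₀
    rw [← hasDerivWithinAt_Ioi_iff_Ici]
    have hp := hchp r₀ hr₀.1
    have hd : 0 < ch r₀ / 2 := by positivity
    have hA : HasDerivWithinAt (fun r => Phi (N r) (ch r) - Phi (N r) (ch r₀))
        (Dphi (N r₀) (ch r₀) * (-v r₀)) (Ioi r₀) r₀ := by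
      rw [hasDerivWithinAt_iff_tendsto_slope' self_notMem_Ioi]
      have hsl : Tendsto (slope ch r₀) (𝓝[>] r₀) (𝓝 (-v r₀)) := by
        have := (hchd r₀).hasDerivWithinAt (s := Ioi r₀)
        rwa [hasDerivWithinAt_iff_tendsto_slope' self_notMem_Ioi] at this
      have hDt : Tendsto (fun r => Dphi (N r) (ch r₀)) (𝓝[>] r₀) (𝓝 (Dphi (N r₀) (ch r₀))) :=
        ((h.dc _ hp).tendsto r₀).mono_left nhdsWithin_le_nhds
      have hmain := hDt.mul hsl
      have herr : Tendsto (fun r => slope (fun r => Phi (N r) (ch r) - Phi (N r) (ch r₀)) r₀ r -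
          Dphi (N r) (ch r₀) * slope ch r₀ r) (𝓝[>] r₀) (𝓝 0) := by
        have hz : Tendsto (fun r => M / (ch r₀ / 2) * |ch r - ch r₀| * |slope ch r₀ r|) (𝓝[>] r₀)
            (𝓝 0) := by
          have : Continuous (fun r => M / (ch r₀ / 2) * |ch r - ch r₀|) := by fun_prop
          have := ((this.tendsto r₀).mono_left (nhdsWithin_le_nhds (s := Ioi r₀))).mul hsl.abs
          simpa using this
        refine squeeze_zero_norm' ?_ hz
        filter_upwards [(hlow r₀ hr₀.1).filter_mono nhdsWithin_le_nhds, self_mem_nhdsWithin]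
          with r hr hr'
        have hpos : 0 < r - r₀ := sub_pos.2 hr'
        have hta := (h.good r).phi_taylor hd (half_le_self hp.le) hr
        rw [h.mass] at hta
        have e : slope (fun r => Phi (N r) (ch r) - Phi (N r) (ch r₀)) r₀ r -
          Dphi (N r) (ch r₀) * slope ch r₀ r =
          (Phi (N r) (ch r) - Phi (N r) (ch r₀) - Dphi (N r) (ch r₀) * (ch r - ch r₀)) / (r - r₀) := by
          rw [slope_def_field, slope_def_field]
          ring
        rw [e, slope_def_field, Real.norm_eq_abs, abs_div, abs_div, ← mul_div_assoc]
        gcongr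
      have := herr.add hmain
      rw [zero_add] at this
      refine this.congr fun r => ?_
      ring
    have hB := h.phi_hasDeriv hp hr₀.1
    have hC := (hA.add hB).sub (hvd r₀).hasDerivWithinAt
    refine (hC.congr_deriv ?_).congr (fun r _ => ?_) ?_
    · ring
    · simp
    · simp
  have hinit : Phi (N 0) (ch 0) - v 0 = 0 := by
    have h1 : ch 0 = s₀ := by simp [hch, aT_zero]
    have h2 := h.evol s₀ 0 hs₀p le_rfl
    rw [intervalIntegral.integral_same, add_zero] at h2
    rw [h1, h2]
    simp [hv]
  have hfin := eq_zero_of_abs_deriv_le_mul_abs_self_of_eq_zero_right (K := M) hucont huder hinit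
    (fun r hr => by
      rw [norm_mul]
      gcongr
      have h1 := (h.good r).dphi_nonneg (ch r)
      have h2 := (h.good r).dphi_le (hchp r hr.1).le
      rw [h.mass] at h2
      rw [Real.norm_eq_abs, abs_le]
      constructor <;> linarith) t ⟨ht, le_rfl⟩
  simp only [hcht] at hfin
  simp only [hv] at hfin
  linarith

theorem unique {N' : ℝ → Measure ℝ} (h : SolFam ν N) (h' : SolFam ν N') {t : ℝ} (ht : 0 ≤ t) :
    N t = N' t :=
  (h.good t).ext_of_phi (h'.good t) fun s hs => by rw [h.phi_formula hs ht, h'.phi_formula hs ht]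

end SolFam

/-! ### Every weak solution is a solution family -/

lemma good_of_solution {ν₀ : Measure ℝ} {ν' : ℝ → Measure ℝ} (h : IsCoagSolutionAdd ν₀ ν')
    {t : ℝ} (ht : 0 ≤ t) : Good (ν' t) := by
  obtain ⟨hs, -, -, hw⟩ := h
  have hsupp := hs t ht
  obtain ⟨h1, h2, -, -⟩ := hw _ (memE1_expf one_pos) t ht
  have h1 := h1 t ⟨ht, le_rfl⟩
  rw [IntegrableOn, restrict_of_supp hsupp] at h2
  have hpos := ae_pos_of_supp hsupp
  have hsf : SigmaFinite (ν' t) := by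
    refine sigmaFinite_of_int h2 ?_
    filter_upwards [hpos] with x hx
    have : Real.exp (-1 * x) < 1 := by
      rw [Real.exp_lt_one_iff]; linarith
    linarith
  rw [IntegrableOn, ← Measure.prod_restrict, restrict_of_supp hsupp] at h1
  rcases eq_or_ne (ν' t) 0 with h0 | h0
  · rw [h0]
    exact ⟨by simp, by simp⟩
  have : (ae (ν' t)).NeBot := ae_neBot.2 h0
  obtain ⟨x, hx, hxp⟩ := (h1.prod_right_ae.and hpos).exists
  refine ⟨hsupp, ?_⟩
  have hne : -(1 - Real.exp (-1 * x)) ≠ 0 := by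
    have : Real.exp (-1 * x) < 1 := by
      rw [Real.exp_lt_one_iff]; linarith
    linarith
  have h3 : Integrable (fun y => (1 - Real.exp (-1 * y)) * (x + y)) (ν' t) := by
    have := hx.const_mul (-(1 - Real.exp (-1 * x)))⁻¹
    refine this.congr (ae_of_all _ fun y => ?_)
    have e : Real.exp (-1 * (x + y)) = Real.exp (-1 * x) * Real.exp (-1 * y) := by
      rw [← Real.exp_add]; ring_nf
    simp only [e]
    have e2 : (1 - Real.exp (-1 * x) * Real.exp (-1 * y) - (1 - Real.exp (-1 * x))
        - (1 - Real.exp (-1 * y))) * (x + y) =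
        -(1 - Real.exp (-1 * x)) * ((1 - Real.exp (-1 * y)) * (x + y)) := by ring
    rw [e2, ← mul_assoc, inv_mul_cancel₀ hne, one_mul]
  refine (h3.add h2).mono' (by fun_prop) ?_
  filter_upwards [hpos] with y hy
  rw [Real.norm_of_nonneg hy.le]
  simp only [Pi.add_apply]
  have e1 := Real.add_one_le_exp y
  have e2 : Real.exp y * Real.exp (-1 * y) = 1 := by
    rw [← Real.exp_add]; simp
  have e3 := Real.exp_pos (-1 * y)
  have e4 : Real.exp (-1 * y) * (y + 1) ≤ 1 := by nlinarith
  have e5 : 0 ≤ (1 - Real.exp (-1 * y)) * x :=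
    mul_nonneg (one_sub_exp_nonneg one_pos.le hy.le) hxp.le
  nlinarith

lemma solFam_of_solution {ν₀ : Measure ℝ} {ν' : ℝ → Measure ℝ} (hg0 : Good ν₀)
    (h : IsCoagSolutionAdd ν₀ ν') : SolFam ν₀ (fun t => ν' (max t 0)) := by
  set κ : ℝ → Measure ℝ := fun t => ν' (max t 0) with hκ
  have hg : ∀ t, Good (κ t) := fun t => good_of_solution h (le_max_right _ _)
  have hκe : ∀ t, 0 ≤ t → κ t = ν' t := fun t ht => by simp [hκ, max_eq_left ht]
  have hκm : ∀ t, κ t = κ (max t 0) := fun t => by simp [hκ]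
  have hmeas : Measurable κ := measurable_of_compact hg fun B hB hB' =>
    (h.2.1 B hB hB').comp (measurable_id.max measurable_const)
  have hmm := measurable_mass hmeas hg
  have hev : ∀ s t, 0 < s → 0 ≤ t → Phi (κ t) s = Phi ν₀ s +
      ∫ τ in (0:ℝ)..t, -(Phi (κ τ) s * (mass (κ τ) - Dphi (κ τ) s)) := by
    intro s t hs ht
    have h4 := (h.2.2.2 _ (memE1_expf hs) t ht).2.2.2
    rw [← hκe t ht, (hg t).restr, hg0.restr] at h4
    rw [Phi, h4, Phi]
    congr 1
    refine intervalIntegral.integral_congr fun τ hτ => ?_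
    rw [uIcc_of_le ht] at hτ
    rw [← hκe τ hτ.1]
    exact (hg τ).pair_expf hs.le
  have hsq : ∀ t, 0 ≤ t → IntervalIntegrable (fun τ => mass (κ τ) ^ 2) volume 0 t := by
    intro t ht
    rw [intervalIntegrable_iff_integrableOn_Ioc_of_le ht]
    rcases ht.eq_or_lt with rfl | ht'
    · simp
    refine (h.2.2.1 t ht').congr_fun (fun τ hτ => ?_) measurableSet_Ioc
    simp only
    rw [← hκe τ hτ.1.le, (hg τ).massMoment_eq, ENNReal.toReal_ofReal (hg τ).mass_nonneg]
  -- mass conservation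
  have hmass0 : ∀ t, 0 ≤ t → mass (κ t) = mass ν₀ := by
    intro t ht
    have hσ : Tendsto (fun n : ℕ => (1:ℝ) / ((n:ℝ) + 1)) atTop (𝓝[>] 0) :=
      tendsto_nhdsWithin_iff.2 ⟨tendsto_one_div_add_atTop_nhds_zero_nat,
        Eventually.of_forall fun n => by simp only [mem_Ioi]; positivity⟩
    set σ : ℕ → ℝ := fun n => (1:ℝ) / ((n:ℝ) + 1) with hσd
    have hσp : ∀ n, 0 < σ n := fun n => by simp only [hσd]; positivity
    have l1 := (hg t).phi_div_tendsto.comp hσ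
    have l2 := hg0.phi_div_tendsto.comp hσ
    have l3 : Tendsto (fun n => ∫ τ in (0:ℝ)..t,
        -(Phi (κ τ) (σ n) / σ n * (mass (κ τ) - Dphi (κ τ) (σ n)))) atTop
        (𝓝 (∫ τ in (0:ℝ)..t, (0:ℝ))) := by
      refine intervalIntegral.tendsto_integral_filter_of_dominated_convergence
        (fun τ => mass (κ τ) ^ 2) ?_ ?_ (hsq t ht) ?_
      · refine Eventually.of_forall fun n => ?_
        have a1 := measurable_phi hmeas hg (hσp n).le
        have a2 := measurable_dphi hmeas hg (σ n)
        exact (((a1.div_const _).mul (hmm.sub a2)).neg).aestronglyMeasurable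
      · refine Eventually.of_forall fun n => ae_of_all _ fun τ _ => ?_
        have b1 := (hg τ).phi_nonneg (hσp n).le
        have b2 := (hg τ).phi_le (hσp n).le
        have b3 := (hg τ).dphi_nonneg (σ n)
        have b4 := (hg τ).dphi_le (hσp n).le
        rw [norm_neg, norm_mul, Real.norm_of_nonneg (div_nonneg b1 (hσp n).le),
          Real.norm_of_nonneg (sub_nonneg.2 b4), sq]
        have b5 : Phi (κ τ) (σ n) / σ n ≤ mass (κ τ) := by
          rwa [div_le_iff₀ (hσp n)]
        exact mul_le_mul b5 (by linarith) (sub_nonneg.2 b4) (hg τ).mass_nonneg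
      · refine ae_of_all _ fun τ _ => ?_
        have c1 := (hg τ).phi_div_tendsto.comp hσ
        have c2 : Tendsto (fun n => Dphi (κ τ) (σ n)) atTop (𝓝 (mass (κ τ))) := by
          have := (hg τ).dphi_cont 0 self_mem_Ici
          rw [ContinuousWithinAt, dphi_zero] at this
          exact this.comp (hσ.mono_right (nhdsWithin_mono _ Ioi_subset_Ici_self))
        have := (c1.mul (c2.const_sub (mass (κ τ)))).neg
        simpa using this
    rw [intervalIntegral.integral_zero] at l3
    have l4 := l2.add l3
    rw [add_zero] at l4
    refine tendsto_nhds_unique l1 (l4.congr fun n => ?_)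
    simp only [Function.comp]
    rw [hev (σ n) t (hσp n) ht, add_div, ← intervalIntegral.integral_div]
    congr 1
    refine intervalIntegral.integral_congr fun τ _ => ?_
    ring
  have hmass : ∀ t, mass (κ t) = mass ν₀ := fun t => by
    rw [hκm]; exact hmass0 _ (le_max_right _ _)
  have hM0 := hg0.mass_nonneg
  simp only [hmass] at hev
  have hpc : ∀ s, 0 < s → Continuous fun t => Phi (κ t) s := by
    intro s hs
    have a1 := measurable_phi hmeas hg hs.le
    have a2 := measurable_dphi hmeas hg s
    have hintg : ∀ a b, IntervalIntegrable
        (fun τ => -(Phi (κ τ) s * (mass ν₀ - Dphi (κ τ) s))) volume a b := by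
      intro a b
      refine (intervalIntegrable_const (c := mass ν₀ * s * mass ν₀)).mono_fun
        ((a1.mul (a2.const_sub _)).neg).aestronglyMeasurable (ae_of_all _ fun τ => ?_)
      have b1 := (hg τ).phi_nonneg hs.le
      have b2 := (hg τ).phi_le hs.le
      have b3 := (hg τ).dphi_nonneg s
      have b4 := (hg τ).dphi_le hs.le
      rw [hmass] at b2 b4
      beta_reduce
      rw [norm_neg, norm_mul, Real.norm_of_nonneg b1, Real.norm_of_nonneg (sub_nonneg.2 b4),
        Real.norm_of_nonneg (by positivity)]
      exact mul_le_mul b2 (by linarith) (sub_nonneg.2 b4) (by positivity)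
    have hc := intervalIntegral.continuous_primitive hintg 0
    have hc2 : Continuous fun t => Phi ν₀ s + ∫ τ in (0:ℝ)..(max t 0),
        -(Phi (κ τ) s * (mass ν₀ - Dphi (κ τ) s)) :=
      continuous_const.add (hc.comp (continuous_id.max continuous_const))
    refine hc2.congr fun t => ?_
    rw [hκm t, hev s _ hs (le_max_right _ _)]
  refine ⟨hg0, hg, hmass, hpc, fun s hs => ?_, hev⟩
  refine cont_of_approx fun δ hδ => ?_
  set η := δ * s / (mass ν₀ + 1) with hη
  have hηp : 0 < η := by positivity
  refine ⟨fun t => (Phi (κ t) (s + η) - Phi (κ t) s) / η,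
    ((hpc _ (by positivity)).sub (hpc s hs)).div_const _, fun t => ?_⟩
  have := (hg t).phi_taylor hs le_rfl (s' := s + η) (by linarith)
  rw [add_sub_cancel_left, hmass, abs_of_pos hηp] at this
  have e : Dphi (κ t) s - (Phi (κ t) (s + η) - Phi (κ t) s) / η =
      -(Phi (κ t) (s + η) - Phi (κ t) s - Dphi (κ t) s * η) / η := by
    field_simp
    ring
  rw [e, abs_div, abs_neg, abs_of_pos hηp, div_le_iff₀ hηp]
  refine this.trans ?_
  gcongr
  rw [hη]
  have : mass ν₀ / s * (δ * s / (mass ν₀ + 1)) = δ * mass ν₀ / (mass ν₀ + 1) := by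
    field_simp
  rw [this, div_le_iff₀ (by positivity)]
  nlinarith

theorem additive_kernel_well_posedness
    (ν₀ : Measure ℝ) (hν₀supp : ν₀ (Set.Iic 0) = 0)
    (hm₁ : massMoment ν₀ < ⊤) :
    ∃ ν : ℝ → Measure ℝ,
      IsCoagSolutionAdd ν₀ ν ∧
      -- conservation of mass
      (∀ t : ℝ, 0 ≤ t → massMoment (ν t) = massMoment ν₀) ∧
      -- uniqueness: any solution coincides with it
      (∀ ν' : ℝ → Measure ℝ, IsCoagSolutionAdd ν₀ ν' →
        ∀ t : ℝ, 0 ≤ t → ν' t = ν t) := by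
  have hg0 : Good ν₀ := good_of_massMoment hν₀supp hm₁
  obtain ⟨N, hNm, hG, hm, hP, hD⟩ := exists_sol hg0
  have hF : SolFam ν₀ N := ⟨hg0, hG, hm, fun s hs => (sol_cont hg0 hNm hP hD hs.le).1,
    fun s hs => (sol_cont hg0 hNm hP hD hs.le).2, fun s t hs ht => sol_evol hg0 hNm hP hD hs ht⟩
  refine ⟨N, hF.isSolution, fun t _ => ?_, fun ν' hν' t ht => ?_⟩
  · rw [(hG t).massMoment_eq, hg0.massMoment_eq, hm]
  · have := (solFam_of_solution hg0 hν').unique hF ht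
    simp only [max_eq_left ht] at this
    exact this
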